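/- arXiv:2304.14744 — 2 statements merged into one kernel-verified Lean document; each statement's English description precedes it below -/
import Mathlib

section
/- There exist constants η > 0 and C > 0 such that the following holds. Let ζ, θ ∈ ℝ and μ, λ > 0, and let g be a complex-valued radially symmetric Schwartz function with |ζ + π/2| + |μ − 1| + |θ| + λ + ‖g‖_𝓔 ≤ η, satisfying the orthogonality conditions ⟨ie^{iζ}ΛW_μ, g⟩ = ⟨e^{iζ}W_μ, g⟩ = ⟨ie^{iθ}ΛW_λ, g⟩ = ⟨e^{iθ}W_λ, g⟩ = 0. Then, with u = e^{iζ}W_μ + e^{iθ}W_λ + g, |E(u) − 2E(W)| ≤ C·( (|ζ + π/2| + |μ − 1| + |θ| + λ)·λ^{(N−4)/2} + ‖g‖_𝓔² ). -/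
open MeasureTheory

noncomputable section

abbrev Rn (N : ℕ) : Type := EuclideanSpace ℝ (Fin N)

noncomputable def lapR {N : ℕ} (u : Rn N → ℝ) (x : Rn N) : ℝ :=
  ∑ i : Fin N, iteratedFDeriv ℝ 2 u x (fun _ => EuclideanSpace.single i 1)

noncomputable def lapC {N : ℕ} (u : Rn N → ℂ) (x : Rn N) : ℂ :=
  ∑ i : Fin N, iteratedFDeriv ℝ 2 u x (fun _ => EuclideanSpace.single i 1)

noncomputable def Wfun (N : ℕ) (x : Rn N) : ℝ :=
  ((N : ℝ) * ((N : ℝ) - 4) * ((N : ℝ) ^ 2 - 4)) ^ (((N : ℝ) - 4) / 8) *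
    (1 + ‖x‖ ^ 2) ^ (-(((N : ℝ) - 4) / 2))

noncomputable def LamR {N : ℕ} (v : Rn N → ℝ) (x : Rn N) : ℝ :=
  (((N : ℝ) - 4) / 2) * v x + fderiv ℝ v x x

noncomputable def LamC {N : ℕ} (v : Rn N → ℂ) (x : Rn N) : ℂ :=
  ((((N : ℝ) - 4) / 2) : ℝ) * v x + fderiv ℝ v x x

noncomputable def rescR {N : ℕ} (lam : ℝ) (u : Rn N → ℝ) (x : Rn N) : ℝ :=
  lam ^ (-(((N : ℝ) - 4) / 2)) * u (lam⁻¹ • x)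

noncomputable def fNL (N : ℕ) (z : ℂ) : ℂ :=
  Complex.ofReal (‖z‖ ^ ((8 : ℝ) / ((N : ℝ) - 4))) * z

noncomputable def fNL' (N : ℕ) (z w : ℂ) : ℂ :=
  if z = 0 then 0 else
    Complex.ofReal (‖z‖ ^ ((8 : ℝ) / ((N : ℝ) - 4))) *
      (w + Complex.ofReal (((8 : ℝ) / ((N : ℝ) - 4)) * ((((starRingEnd ℂ) z) * w).re / ‖z‖ ^ 2)) * z)

noncomputable def FNL (N : ℕ) (z : ℂ) : ℝ :=
  (((N : ℝ) - 4) / (2 * (N : ℝ))) * ‖z‖ ^ ((2 * (N : ℝ)) / ((N : ℝ) - 4))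

noncomputable def cexp (θ : ℝ) : ℂ := Complex.exp (Complex.I * θ)

noncomputable def pairC {N : ℕ} (v w : Rn N → ℂ) : ℝ :=
  ∫ x : Rn N, ((starRingEnd ℂ) (v x) * w x).re

noncomputable def energyC {N : ℕ} (u : Rn N → ℂ) : ℝ :=
  (1 / 2) * (∫ x : Rn N, ‖lapC u x‖ ^ 2) - (∫ x : Rn N, FNL N (u x))

noncomputable def enorm2 {N : ℕ} (g : Rn N → ℂ) : ℝ := ∫ x : Rn N, ‖lapC g x‖ ^ 2

section part1

/-- the power nonlinearity on ℂ -/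
def fs (s : ℝ) (z : ℂ) : ℂ := (‖z‖ ^ s : ℝ) • z

lemma fs_norm (s : ℝ) (hs : 0 < s) (z : ℂ) : ‖fs s z‖ = ‖z‖ ^ (s + 1) := by
  unfold fs
  rw [norm_smul, Real.norm_of_nonneg (by positivity), Real.rpow_add_one' (norm_nonneg z) (by linarith)]

lemma rpow_aux (s a b : ℝ) (hs1 : s ≤ 1) (hb : 0 ≤ b) (hab : b ≤ a) :
    (a ^ s - b ^ s) * b ≤ a ^ s * (a - b) := by
  rcases hb.eq_or_lt with rfl | hb0
  · simp only [mul_zero, sub_zero]; positivity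
  have ha : 0 < a := lt_of_lt_of_le hb0 hab
  have h1 : a ^ s * (b / a) ≤ b ^ s := by
    have h2 : b / a ≤ (b / a) ^ s := by
      have := Real.rpow_le_rpow_of_exponent_ge (x := b / a) (by positivity)
        ((div_le_one ha).2 hab) hs1
      simpa using this
    calc a ^ s * (b / a) ≤ a ^ s * (b / a) ^ s := by gcongr
      _ = b ^ s := by
        rw [← Real.mul_rpow ha.le (by positivity)]
        congr 1; field_simp
  have has : 0 < a ^ s := by positivity
  have h3 : (a ^ s - b ^ s) * b ≤ (a ^ s - a ^ s * (b / a)) * b := by gcongr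
  refine h3.trans ?_
  have : (a ^ s - a ^ s * (b / a)) * b = a ^ s * (a - b) * (b / a) := by field_simp
  rw [this]
  have h4 : b / a ≤ 1 := (div_le_one ha).2 hab
  have h5 : 0 ≤ a ^ s * (a - b) := mul_nonneg has.le (by linarith)
  nlinarith

lemma fs_lip_aux (s : ℝ) (hs : 0 < s) (hs1 : s ≤ 1) (z y : ℂ) (h : ‖y‖ ≤ ‖z‖) :
    ‖fs s z - fs s y‖ ≤ 2 * ‖z‖ ^ s * ‖z - y‖ := by
  have e : fs s z - fs s y = (‖z‖ ^ s : ℝ) • (z - y) + (‖z‖ ^ s - ‖y‖ ^ s : ℝ) • y := by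
    unfold fs; rw [smul_sub, sub_smul]; ring
  rw [e]
  have h0 : ‖y‖ ^ s ≤ ‖z‖ ^ s := Real.rpow_le_rpow (norm_nonneg _) h hs.le
  refine (norm_add_le _ _).trans ?_
  rw [norm_smul, norm_smul, Real.norm_of_nonneg (by positivity),
    Real.norm_of_nonneg (by linarith)]
  have h1 := rpow_aux s ‖z‖ ‖y‖ hs1 (norm_nonneg _) h
  have h2 : ‖z‖ - ‖y‖ ≤ ‖z - y‖ := norm_sub_norm_le z y
  have h3 : ‖z‖ ^ s * (‖z‖ - ‖y‖) ≤ ‖z‖ ^ s * ‖z - y‖ := by gcongr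
  linarith

lemma fs_lip (s : ℝ) (hs : 0 < s) (hs1 : s ≤ 1) (z y : ℂ) (m : ℝ) (hz : ‖z‖ ≤ m) (hy : ‖y‖ ≤ m) :
    ‖fs s z - fs s y‖ ≤ 2 * m ^ s * ‖z - y‖ := by
  have key : ∀ t : ℝ, 0 ≤ t → t ≤ m → 2 * t ^ s * ‖z - y‖ ≤ 2 * m ^ s * ‖z - y‖ := by
    intro t ht htm
    gcongr
  rcases le_total ‖y‖ ‖z‖ with h | h
  · exact (fs_lip_aux s hs hs1 z y h).trans (key _ (norm_nonneg _) hz)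
  · rw [norm_sub_rev]
    refine (fs_lip_aux s hs hs1 y z h).trans ?_
    rw [norm_sub_rev]
    exact key _ (norm_nonneg _) hy

/-- primitive -/
def Fs (s : ℝ) (z : ℂ) : ℝ := (1 / (s + 2)) * ‖z‖ ^ (s + 2)

lemma Fs_hasFDeriv (s : ℝ) (hs : 0 < s) (z : ℂ) :
    HasFDerivAt (Fs s) (innerSL ℝ (fs s z)) z := by
  have h := (hasFDerivAt_norm_rpow z (p := s + 2) (by linarith)).const_mul (1 / (s + 2))
  refine h.congr_fderiv ?_
  ext w
  all_goals
    simp [fs]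
    have : s + 2 ≠ 0 := by linarith
    field_simp

lemma Fs_taylor (s : ℝ) (hs : 0 < s) (hs1 : s ≤ 1) (z w : ℂ) :
    |Fs s (z + w) - Fs s z - inner ℝ (fs s z) w| ≤ 2 * (‖z‖ + ‖w‖) ^ s * ‖w‖ ^ 2 := by
  have hd : ∀ y : ℂ, HasFDerivAt (fun y => Fs s y - inner ℝ (fs s z) y)
      (innerSL ℝ (fs s y) - innerSL ℝ (fs s z)) y := by
    intro y
    exact (Fs_hasFDeriv s hs y).sub ((innerSL ℝ (fs s z)).hasFDerivAt)
  have := (convex_segment z (z + w)).norm_image_sub_le_of_norm_hasFDerivWithin_le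
    (f := fun y => Fs s y - inner ℝ (fs s z) y) (C := 2 * (‖z‖ + ‖w‖) ^ s * ‖w‖)
    (fun y _ => (hd y).hasFDerivWithinAt) ?_ (left_mem_segment ℝ _ _) (right_mem_segment ℝ _ _)
  · rw [Real.norm_eq_abs] at this
    simp only [inner_add_right, add_sub_cancel_left] at this
    calc _ = |Fs s (z + w) - (inner ℝ (fs s z) z + inner ℝ (fs s z) w) - (Fs s z - inner ℝ (fs s z) z)| := by
          congr 1; ring
      _ ≤ _ := this
      _ = _ := by ring
  · intro y hy
    rw [segment_eq_image'] at hy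
    obtain ⟨t, ⟨ht0, ht1⟩, rfl⟩ := hy
    simp only [add_sub_cancel_left]
    rw [← map_sub, innerSL_apply_norm]
    have hw : ‖t • w‖ ≤ ‖w‖ := by
      rw [norm_smul, Real.norm_of_nonneg ht0]
      have := norm_nonneg w
      nlinarith
    refine (fs_lip s hs hs1 (z + t • w) z (‖z‖ + ‖w‖) ?_ ?_).trans ?_
    · exact (norm_add_le _ _).trans (by linarith)
    · linarith [norm_nonneg w]
    · rw [add_sub_cancel_left]
      gcongr

lemma Fs_taylor' (s : ℝ) (hs : 0 < s) (hs1 : s ≤ 1) (z w : ℂ) :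
    |Fs s (z + w) - Fs s z - inner ℝ (fs s z) w| ≤ 2 * ‖z‖ ^ s * ‖w‖ ^ 2 + 2 * ‖w‖ ^ (s + 2) := by
  refine (Fs_taylor s hs hs1 z w).trans ?_
  have h : (‖z‖ + ‖w‖) ^ s ≤ ‖z‖ ^ s + ‖w‖ ^ s :=
    Real.rpow_add_le_add_rpow (norm_nonneg _) (norm_nonneg _) hs.le hs1
  have e : ‖w‖ ^ (s + 2) = ‖w‖ ^ s * ‖w‖ ^ 2 := by
    rw [Real.rpow_add_of_nonneg (norm_nonneg _) hs.le (by norm_num)]; norm_num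
  rw [e]
  have : 0 ≤ ‖w‖ ^ 2 := by positivity
  nlinarith

/-- exponent shifting: for `y ≤ x`. -/
lemma rpow_shift (x y e d a b : ℝ) (hy : 0 ≤ y) (hxy : y ≤ x) (hd : 0 ≤ b) (ha : 0 ≤ a) (he : 0 ≤ e)
    (hbd : b ≤ d) (hsum : a + b = e + d) :
    x ^ e * y ^ d ≤ x ^ a * y ^ b := by
  have h1 : y ^ d = y ^ b * y ^ (d - b) := by
    rw [← Real.rpow_add_of_nonneg hy hd (by linarith)]; congr 1; ring
  have hx : 0 ≤ x := hy.trans hxy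
  have h2 : x ^ a = x ^ e * x ^ (d - b) := by
    rw [← Real.rpow_add_of_nonneg hx he (by linarith)]; congr 1; linarith
  rw [h1, h2]
  have : y ^ (d - b) ≤ x ^ (d - b) := Real.rpow_le_rpow hy hxy (by linarith)
  calc x ^ e * (y ^ b * y ^ (d - b)) ≤ x ^ e * (y ^ b * x ^ (d - b)) := by gcongr
    _ = _ := by ring

lemma inner_fs (s : ℝ) (z w : ℂ) : inner ℝ (fs s z) w = ‖z‖ ^ s * inner ℝ z w := by
  unfold fs; rw [real_inner_smul_left]

lemma Fs_sum_aux (s : ℝ) (hs : 0 < s) (hs1 : s ≤ 1) (z w : ℂ) (h : ‖w‖ ≤ ‖z‖) :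
    |Fs s (z + w) - Fs s z - Fs s w| ≤ ‖z‖ ^ s * |inner ℝ z w| + 5 * (‖z‖ ^ s * ‖w‖ ^ (2:ℝ)) := by
  have h1 := Fs_taylor' s hs hs1 z w
  have e : ‖w‖ ^ (s + 2) = ‖w‖ ^ s * ‖w‖ ^ (2:ℝ) :=
    Real.rpow_add_of_nonneg (norm_nonneg _) hs.le (by norm_num)
  have h2 : ‖w‖ ^ s ≤ ‖z‖ ^ s := Real.rpow_le_rpow (norm_nonneg _) h hs.le
  have h0 : 0 ≤ ‖w‖ ^ (2:ℝ) := by positivity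
  have h3 : ‖w‖ ^ (s + 2) ≤ ‖z‖ ^ s * ‖w‖ ^ (2:ℝ) := by rw [e]; gcongr
  have h4 : |Fs s w| ≤ ‖w‖ ^ (s + 2) := by
    unfold Fs
    rw [abs_of_nonneg (by positivity)]
    have : 1 / (s + 2) ≤ 1 := by rw [div_le_one (by linarith)]; linarith
    have h5 : 0 ≤ ‖w‖ ^ (s + 2) := by positivity
    nlinarith
  have h6 : |inner ℝ (fs s z) w| = ‖z‖ ^ s * |inner ℝ z w| := by
    rw [inner_fs, abs_mul, abs_of_nonneg (by positivity : 0 ≤ ‖z‖ ^ s)]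
  have h7 : ‖w‖ ^ (2:ℝ) = ‖w‖ ^ 2 := by norm_num
  rw [← h7] at h1
  rw [abs_le] at *
  have := abs_le.1 h6.le
  constructor <;> linarith [h1.1, h1.2, h4.1, h4.2]

lemma Fs_sum (s : ℝ) (hs : 0 < s) (hs1 : s ≤ 1) (a b : ℝ) (ha : s ≤ a) (hb : s ≤ b)
    (hab : a + b = s + 2) (z w : ℂ) :
    |Fs s (z + w) - Fs s z - Fs s w| ≤
      (‖z‖ ^ s + ‖w‖ ^ s) * |inner ℝ z w| + 5 * (‖z‖ ^ a * ‖w‖ ^ b) := by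
  have hz : 0 ≤ ‖z‖ ^ s * |inner ℝ z w| := by positivity
  have hw : 0 ≤ ‖w‖ ^ s * |inner ℝ z w| := by positivity
  rcases le_total ‖w‖ ‖z‖ with h | h
  · have h1 := Fs_sum_aux s hs hs1 z w h
    have h2 := rpow_shift ‖z‖ ‖w‖ s 2 a b (norm_nonneg _) h (by linarith) (by linarith) hs.le
      (by linarith) hab
    linarith
  · have h1 := Fs_sum_aux s hs hs1 w z h
    have h2 := rpow_shift ‖w‖ ‖z‖ s 2 b a (norm_nonneg _) h (by linarith) (by linarith) hs.le
      (by linarith) (by linarith)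
    rw [add_comm z w, real_inner_comm w z, sub_right_comm]
    rw [real_inner_comm w z] at hz
    linarith

lemma fs_sum_aux (s : ℝ) (hs : 0 < s) (hs1 : s ≤ 1) (z w : ℂ) (h : ‖w‖ ≤ ‖z‖) :
    ‖fs s (z + w) - fs s z - fs s w‖ ≤ 5 * (‖z‖ ^ s * ‖w‖ ^ (1:ℝ)) := by
  refine (norm_sub_le _ _).trans ?_
  rw [fs_norm s hs w, Real.rpow_one, Real.rpow_add_one' (norm_nonneg w) (by linarith)]
  have h1 := fs_lip s hs hs1 (z + w) z (2 * ‖z‖) ((norm_add_le _ _).trans (by linarith))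
    (by linarith [norm_nonneg z])
  rw [add_sub_cancel_left, Real.mul_rpow (by norm_num) (norm_nonneg _)] at h1
  have h2 : (2:ℝ) ^ s ≤ 2 := by
    simpa using Real.rpow_le_rpow_of_exponent_le (x := 2) (by norm_num) hs1
  have h3 : ‖w‖ ^ s * ‖w‖ ≤ ‖z‖ ^ s * ‖w‖ := by gcongr
  have h4 : 2 * (2 ^ s * ‖z‖ ^ s) * ‖w‖ ≤ 2 * (2 * ‖z‖ ^ s) * ‖w‖ := by gcongr
  linarith

lemma fs_sum (s : ℝ) (hs : 0 < s) (hs1 : s ≤ 1) (a b : ℝ) (ha : s ≤ a) (hb : s ≤ b)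
    (hab : a + b = s + 1) (z w : ℂ) :
    ‖fs s (z + w) - fs s z - fs s w‖ ≤ 5 * (‖z‖ ^ a * ‖w‖ ^ b) := by
  rcases le_total ‖w‖ ‖z‖ with h | h
  · have h1 := fs_sum_aux s hs hs1 z w h
    have h2 := rpow_shift ‖z‖ ‖w‖ s 1 a b (norm_nonneg _) h (by linarith) (by linarith) hs.le
      (by linarith) hab
    linarith
  · have h1 := fs_sum_aux s hs hs1 w z h
    have h2 := rpow_shift ‖w‖ ‖z‖ s 1 b a (norm_nonneg _) h (by linarith) (by linarith) hs.le
      (by linarith) (by linarith)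
    rw [add_comm z w, sub_right_comm]
    linarith

end part1

section part2

open scoped SchwartzMap LineDeriv Laplacian NNReal ENNReal

section gns
variable {E F : Type*} [NormedAddCommGroup E] [InnerProductSpace ℝ E] [MeasurableSpace E]
  [BorelSpace E] [FiniteDimensional ℝ E] [NormedAddCommGroup F] [NormedSpace ℝ F]
  [FiniteDimensional ℝ F]

lemma gns_schwartz (p p' : ℝ≥0) (hp : 1 ≤ p) (hn : 0 < Module.finrank ℝ E)
    (hp' : (p' : ℝ)⁻¹ = (p : ℝ)⁻¹ - (Module.finrank ℝ E : ℝ)⁻¹) (g : 𝓢(E, F)) :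
    eLpNorm g p' volume ≤
      SNormLESNormFDerivOfEqConst F (volume : Measure E) p * eLpNorm (fderiv ℝ g) p volume := by
  let χ : ContDiffBump (0 : E) := ⟨1, 2, by norm_num, by norm_num⟩
  have hχ : ContDiff ℝ 1 (χ : E → ℝ) := χ.contDiff
  obtain ⟨K, hK⟩ := (hχ.continuous_fderiv one_ne_zero).bounded_above_of_compact_support
    (χ.hasCompactSupport.fderiv (𝕜 := ℝ))
  have hK0 : 0 ≤ K := (norm_nonneg _).trans (hK 0)
  let c : ℕ → ℝ := fun n => ((n : ℝ) + 1)⁻¹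
  have hc : ∀ n, 0 < c n := fun n => by positivity
  let gn : ℕ → E → F := fun n x => χ (c n • x) • g x
  have hg1 : ContDiff ℝ 1 g := g.smooth 1
  have hcd : ∀ n, ContDiff ℝ 1 (fun x => χ (c n • x)) := fun n =>
    hχ.comp (contDiff_const_smul (c n))
  have hgn : ∀ n, ContDiff ℝ 1 (gn n) := fun n => (hcd n).smul hg1
  have hsupp : ∀ n, HasCompactSupport (gn n) := fun n =>
    (χ.hasCompactSupport.comp_smul (hc n).ne').smul_right
  set A := SNormLESNormFDerivOfEqConst F (volume : Measure E) p with hA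
  have hder : ∀ n x, ‖fderiv ℝ (gn n) x‖ ≤ ‖fderiv ℝ g x‖ + (c n * K) * ‖g x‖ := by
    intro n x
    have h1 : fderiv ℝ (gn n) x = _ := fderiv_fun_smul ((hcd n).differentiable one_ne_zero x)
      (hg1.differentiable one_ne_zero x)
    rw [h1]
    refine (norm_add_le _ _).trans (add_le_add ?_ ?_)
    · rw [norm_smul, Real.norm_of_nonneg χ.nonneg]
      exact mul_le_of_le_one_left (norm_nonneg _) χ.le_one
    · rw [ContinuousLinearMap.norm_smulRight_apply]
      gcongr
      rw [fderiv_comp_smul, norm_smul, Real.norm_of_nonneg (hc n).le]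
      gcongr
      exact hK _
  have hbd : ∀ n, eLpNorm (gn n) p' volume ≤
      A * (eLpNorm (fderiv ℝ g) p volume + ENNReal.ofReal (c n * K) * eLpNorm g p volume) := by
    intro n
    refine (eLpNorm_le_eLpNorm_fderiv_of_eq volume (hgn n) (hsupp n) hp hn hp').trans ?_
    rw [← hA]
    gcongr
    have hmeas : AEStronglyMeasurable (fun x => ‖fderiv ℝ g x‖) volume :=
      (hg1.continuous_fderiv one_ne_zero).norm.aestronglyMeasurable
    calc eLpNorm (fderiv ℝ (gn n)) p volume
        ≤ eLpNorm ((fun x => ‖fderiv ℝ g x‖) + (c n * K) • (fun x => ‖g x‖)) p volume := by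
          refine eLpNorm_mono_real fun x => ?_
          simpa using hder n x
      _ ≤ eLpNorm (fun x => ‖fderiv ℝ g x‖) p volume
          + eLpNorm ((c n * K) • (fun x => ‖g x‖)) p volume :=
          eLpNorm_add_le hmeas ((g.continuous.norm.aestronglyMeasurable).const_smul _)
            (by exact_mod_cast hp)
      _ = _ := by
          rw [eLpNorm_const_smul, eLpNorm_norm, eLpNorm_norm, Real.enorm_of_nonneg (by positivity)]
  have hc0 : Filter.Tendsto c Filter.atTop (nhds 0) := by
    simpa [c] using tendsto_one_div_add_atTop_nhds_zero_nat (𝕜 := ℝ)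
  have hlim : ∀ᵐ x ∂(volume : Measure E), Filter.Tendsto (fun n => gn n x) Filter.atTop (nhds (g x)) := by
    refine Filter.Eventually.of_forall fun x => ?_
    have h1 : Filter.Tendsto (fun n => c n • x) Filter.atTop (nhds 0) := by
      simpa using hc0.smul_const x
    have h2 : Filter.Tendsto (fun n => χ (c n • x)) Filter.atTop (nhds 1) := by
      have := (hχ.continuous.tendsto 0).comp h1
      rwa [χ.one_of_mem_closedBall (Metric.mem_closedBall_self (by norm_num [χ]))] at this
    simpa using h2.smul_const (g x)
  have hfin : Filter.Tendsto (fun n => (A : ℝ≥0∞) * (eLpNorm (fderiv ℝ g) p volume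
      + ENNReal.ofReal (c n * K) * eLpNorm g p volume)) Filter.atTop
      (nhds (A * (eLpNorm (fderiv ℝ g) p volume + 0))) := by
    refine ENNReal.Tendsto.const_mul (tendsto_const_nhds.add ?_) (Or.inr ENNReal.coe_ne_top)
    have : Filter.Tendsto (fun n => ENNReal.ofReal (c n * K)) Filter.atTop (nhds 0) := by
      simpa using ENNReal.tendsto_ofReal (hc0.mul_const K)
    simpa using ENNReal.Tendsto.mul_const this (Or.inr (g.memLp p volume).eLpNorm_ne_top)
  rw [add_zero] at hfin
  calc eLpNorm g p' volume ≤ Filter.liminf (fun n => eLpNorm (gn n) p' volume) Filter.atTop :=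
        Lp.eLpNorm_lim_le_liminf_eLpNorm (fun n => (hgn n).continuous.aestronglyMeasurable) _ hlim
    _ ≤ Filter.liminf (fun n => (A : ℝ≥0∞) * (eLpNorm (fderiv ℝ g) p volume
      + ENNReal.ofReal (c n * K) * eLpNorm g p volume)) Filter.atTop :=
        Filter.liminf_le_liminf (Filter.Eventually.of_forall hbd)
    _ = _ := hfin.liminf_eq

lemma gns_schwartz' (p p' : ℝ≥0) (hp : 1 ≤ p) (hn : 0 < Module.finrank ℝ E)
    (hp' : (p' : ℝ)⁻¹ = (p : ℝ)⁻¹ - (Module.finrank ℝ E : ℝ)⁻¹) (g : 𝓢(E, F))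
    (H : E → ℝ) (hH : ∀ x, ‖fderiv ℝ g x‖ ≤ H x) :
    eLpNorm g p' volume ≤
      SNormLESNormFDerivOfEqConst F (volume : Measure E) p * eLpNorm H p volume := by
  refine (gns_schwartz p p' hp hn hp' g).trans ?_
  gcongr
  exact eLpNorm_mono_real hH
end gns

section hess
variable {N : ℕ}

/-- directional derivative on Schwartz space -/
abbrev dd (v : Rn N) (g : 𝓢(Rn N, ℂ)) : 𝓢(Rn N, ℂ) := ∂_{v} g

abbrev ee (i : Fin N) : Rn N := EuclideanSpace.single i 1

lemma lapC_eq (u : Rn N → ℂ) : lapC u = Δ u := by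
  rw [InnerProductSpace.laplacian_eq_iteratedFDeriv_orthonormalBasis u (EuclideanSpace.basisFun (Fin N) ℝ)]
  ext x
  unfold lapC
  refine Finset.sum_congr rfl fun i _ => ?_
  congr 1
  ext j
  fin_cases j <;> simp

lemma schwartz_lap (g : 𝓢(Rn N, ℂ)) (x : Rn N) :
    lapC g x = ∑ i, dd (ee i) (dd (ee i) g) x := by
  rw [lapC_eq, ← SchwartzMap.laplacian_apply,
    SchwartzMap.laplacian_eq_sum (EuclideanSpace.basisFun (Fin N) ℝ)]
  simp

lemma lineDeriv_comm' (v w : Rn N) (g : 𝓢(Rn N, ℂ)) : dd (v) (dd (w) g) = dd (w) (dd (v) g) := by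
  have key : ∀ (v w : Rn N) (x : Rn N), dd (v) (dd (w) g) x = fderiv ℝ (fderiv ℝ g) x v w := by
    intro v w x
    rw [SchwartzMap.lineDerivOp_apply_eq_fderiv]
    have : (⇑(dd (w) g) : Rn N → ℂ) = fun y => fderiv ℝ g y w := by
      ext y; exact SchwartzMap.lineDerivOp_apply_eq_fderiv w g y
    rw [this]
    have hd : DifferentiableAt ℝ (fderiv ℝ g) x :=
      ((g.smooth 2).fderiv_right (m := 1) (by norm_num)).differentiable one_ne_zero x
    rw [fderiv_clm_apply hd (differentiableAt_const w)]
    simp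
  ext x
  rw [key, key]
  exact ((g.smooth 2).contDiffAt.isSymmSndFDerivAt (by simp)) v w

lemma schwartz_inner_integrable (f g : 𝓢(Rn N, ℂ)) : Integrable (fun x => inner ℝ (f x) (g x)) :=
  L2.integrable_inner (𝕜 := ℝ) (f.toLp 2) (g.toLp 2) |>.congr (by
    filter_upwards [f.coeFn_toLp 2, g.coeFn_toLp 2] with x h1 h2
    rw [h1, h2])

lemma ibp (v : Rn N) (f g : 𝓢(Rn N, ℂ)) :
    ∫ x, inner ℝ (f x) (dd (v) g x) = - ∫ x, inner ℝ (dd (v) f x) (g x) :=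
  SchwartzMap.integral_bilinear_lineDerivOp_right_eq_neg_left f g (innerSL ℝ) v

lemma hess_ij (g : 𝓢(Rn N, ℂ)) (i j : Fin N) :
    ∫ x, inner ℝ (dd (ee i) (dd (ee i) g) x) (dd (ee j) (dd (ee j) g) x) =
      ∫ x, ‖dd (ee i) (dd (ee j) g) x‖ ^ 2 := by
  rw [ibp, lineDeriv_comm' (ee j) (ee i) (dd (ee i) g), lineDeriv_comm' (ee j) (ee i) g]
  simp_rw [fun x => real_inner_comm (dd (ee j) g x) (dd (ee i) (dd (ee i) (dd (ee j) g)) x)]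
  rw [ibp, neg_neg]
  simp

lemma hess_le (g : 𝓢(Rn N, ℂ)) (i j : Fin N) :
    ∫ x, ‖dd (ee i) (dd (ee j) g) x‖ ^ 2 ≤ ∫ x, ‖lapC g x‖ ^ 2 := by
  have h : ∫ x, ‖lapC g x‖ ^ 2 = ∑ i, ∑ j, ∫ x, ‖dd (ee i) (dd (ee j) g) x‖ ^ 2 := by
    simp_rw [schwartz_lap, ← real_inner_self_eq_norm_sq, sum_inner, inner_sum]
    rw [integral_finsetSum _ fun i _ => integrable_finsetSum _ fun j _ => schwartz_inner_integrable _ _]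
    refine Finset.sum_congr rfl fun i _ => ?_
    rw [integral_finsetSum _ fun j _ => schwartz_inner_integrable _ _]
    refine Finset.sum_congr rfl fun j _ => ?_
    rw [hess_ij]
    simp
  rw [h]
  refine le_trans ?_ (Finset.single_le_sum (fun i _ => Finset.sum_nonneg fun j _ => integral_nonneg fun x => by positivity) (Finset.mem_univ i))
  exact Finset.single_le_sum (f := fun j => ∫ x, ‖dd (ee i) (dd (ee j) g) x‖ ^ 2) (fun j _ => integral_nonneg fun x => by positivity) (Finset.mem_univ j)

lemma clm_norm_le {G : Type*} [NormedAddCommGroup G] [NormedSpace ℝ G] (L : Rn N →L[ℝ] G) :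
    ‖L‖ ≤ ∑ i, ‖L (ee i)‖ := by
  refine L.opNorm_le_bound (Finset.sum_nonneg fun i _ => norm_nonneg _) fun v => ?_
  have : v = ∑ i, v i • ee i := by
    conv_lhs => rw [← (EuclideanSpace.basisFun (Fin N) ℝ).sum_repr v]
    simp
  conv_lhs => rw [this]
  rw [map_sum, Finset.sum_mul]
  refine (norm_sum_le _ _).trans (Finset.sum_le_sum fun i _ => ?_)
  rw [map_smul, norm_smul, mul_comm]
  gcongr
  exact PiLp.norm_apply_le v i

lemma fderiv2_norm_le (g : 𝓢(Rn N, ℂ)) (x : Rn N) :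
    ‖fderiv ℝ (SchwartzMap.fderivCLM ℝ (Rn N) ℂ g) x‖ ≤ ∑ i, ∑ j, ‖dd (ee i) (dd (ee j) g) x‖ := by
  refine (clm_norm_le _).trans (Finset.sum_le_sum fun i _ => ?_)
  refine (clm_norm_le _).trans (Finset.sum_le_sum fun j _ => le_of_eq ?_)
  congr 1
  rw [SchwartzMap.lineDerivOp_apply_eq_fderiv]
  have : (⇑(dd (ee j) g) : Rn N → ℂ) = fun y => SchwartzMap.fderivCLM ℝ (Rn N) ℂ g y (ee j) := by
    ext y; exact SchwartzMap.lineDerivOp_apply_eq_fderiv (ee j) g y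
  rw [this, fderiv_clm_apply (SchwartzMap.differentiableAt _) (differentiableAt_const _)]
  simp

lemma schwartz_eLpNorm_two (h : 𝓢(Rn N, ℂ)) :
    eLpNorm h 2 volume = ENNReal.ofReal (Real.sqrt (∫ x, ‖h x‖ ^ 2)) := by
  rw [(h.memLp 2 volume).eLpNorm_eq_integral_rpow_norm (by simp) (by simp)]
  norm_num [Real.sqrt_eq_rpow]

lemma eLpNorm_dsum {α : Type*} [MeasurableSpace α] (m : Measure α) (H : Fin N → Fin N → α → ℝ)
    (hH : ∀ i j, AEStronglyMeasurable (H i j) m) :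
    eLpNorm (fun x => ∑ i, ∑ j, H i j x) 2 m ≤ ∑ i, ∑ j, eLpNorm (H i j) 2 m := by
  have e : (fun x => ∑ i, ∑ j, H i j x) = ∑ i, ∑ j, H i j := by
    ext x; simp [Finset.sum_apply]
  rw [e]
  refine (eLpNorm_sum_le (fun i _ => Finset.aestronglyMeasurable_sum _ fun j _ => hH i j)
    (by norm_num)).trans (Finset.sum_le_sum fun i _ => ?_)
  exact eLpNorm_sum_le (fun j _ => hH i j) (by norm_num)

lemma eLpNorm_fderiv2 (g : 𝓢(Rn N, ℂ)) :
    eLpNorm (fun x => ∑ i : Fin N, ∑ j : Fin N, ‖dd (ee i) (dd (ee j) g) x‖) 2 volume ≤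
      ENNReal.ofReal ((N * N) * Real.sqrt (∫ x, ‖lapC g x‖ ^ 2)) := by
  have h2 := eLpNorm_dsum volume (fun i j x => ‖dd (ee i) (dd (ee j) g) x‖) (fun i j =>
            (SchwartzMap.continuous _).norm.aestronglyMeasurable)
  refine h2.trans ?_
  set S := Real.sqrt (∫ x, ‖lapC g x‖ ^ 2) with hS
  have h3 : ∀ i j : Fin N, eLpNorm (fun x => ‖dd (ee i) (dd (ee j) g) x‖) 2 volume ≤ ENNReal.ofReal S := by
    intro i j
    rw [eLpNorm_norm, schwartz_eLpNorm_two]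
    exact ENNReal.ofReal_le_ofReal (Real.sqrt_le_sqrt (hess_le g i j))
  refine (Finset.sum_le_sum fun i _ => Finset.sum_le_sum fun j _ => h3 i j).trans ?_
  rw [ENNReal.ofReal_mul (by positivity), ENNReal.ofReal_mul (by positivity)]
  simp [mul_assoc]

lemma sobolev (hN : 13 ≤ N) : ∃ C : ℝ, 0 < C ∧ ∀ g : 𝓢(Rn N, ℂ),
    ∫ x, ‖g x‖ ^ (2 * (N : ℝ) / ((N : ℝ) - 4)) ≤
      (C * Real.sqrt (∫ x, ‖lapC g x‖ ^ 2)) ^ (2 * (N : ℝ) / ((N : ℝ) - 4)) := by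
  have hN' : (13 : ℝ) ≤ N := by exact_mod_cast hN
  let p1 : ℝ≥0 := ⟨2 * (N : ℝ) / ((N : ℝ) - 2), div_nonneg (by linarith) (by linarith)⟩
  let p2 : ℝ≥0 := ⟨2 * (N : ℝ) / ((N : ℝ) - 4), div_nonneg (by linarith) (by linarith)⟩
  have hp1 : (p1 : ℝ) = 2 * (N : ℝ) / ((N : ℝ) - 2) := rfl
  have hp2 : (p2 : ℝ) = 2 * (N : ℝ) / ((N : ℝ) - 4) := rfl
  have hfr : Module.finrank ℝ (Rn N) = N := by simp
  set A1 := SNormLESNormFDerivOfEqConst ℂ (volume : Measure (Rn N)) p1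
  set A2 := SNormLESNormFDerivOfEqConst (Rn N →L[ℝ] ℂ) (volume : Measure (Rn N)) (2 : ℝ≥0)
  refine ⟨A1 * A2 * (N * N) + 1, by positivity, fun g => ?_⟩
  set S := Real.sqrt (∫ x, ‖lapC g x‖ ^ 2) with hS
  have h1 := gns_schwartz p1 p2 (by
      rw [← NNReal.coe_le_coe, hp1, NNReal.coe_one, le_div_iff₀ (by linarith)]; linarith)
    (by rw [hfr]; omega) (by
      rw [hp1, hp2, hfr, inv_div, inv_div]
      have : (N:ℝ) ≠ 0 := by linarith
      field_simp
      ring) g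
  have h2 := gns_schwartz' 2 p1 (by norm_num)
    (by rw [hfr]; omega) (by
      rw [hp1, hfr, inv_div]
      have : (N:ℝ) ≠ 0 := by linarith
      push_cast
      field_simp) (SchwartzMap.fderivCLM ℝ (Rn N) ℂ g) _ (fderiv2_norm_le g)
  have h3 : eLpNorm (fun x => ∑ i : Fin N, ∑ j : Fin N, ‖dd (ee i) (dd (ee j) g) x‖) (2 : ℝ≥0) volume ≤
      ENNReal.ofReal ((N * N) * S) := by
    exact_mod_cast eLpNorm_fderiv2 g
  have hS0 : 0 ≤ S := Real.sqrt_nonneg _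
  have h4 : eLpNorm g p2 volume ≤ ENNReal.ofReal (A1 * A2 * (N * N) * S) := by
    calc _ ≤ _ := h1
      _ ≤ A1 * (A2 * ENNReal.ofReal ((N * N) * S)) := by
          gcongr
          exact h2.trans (by gcongr)
      _ = _ := by
          rw [← ENNReal.ofReal_coe_nnreal, ← ENNReal.ofReal_coe_nnreal (p := A2),
            ← ENNReal.ofReal_mul (by positivity), ← ENNReal.ofReal_mul (by positivity)]
          congr 1; ring
  have hp2pos : 0 < (p2 : ℝ) := by rw [hp2]; apply div_pos <;> linarith
  rw [(g.memLp p2 volume).eLpNorm_eq_integral_rpow_norm (by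
      intro h; rw [ENNReal.coe_eq_zero] at h; rw [h] at hp2pos; simp at hp2pos) (by simp)] at h4
  rw [ENNReal.ofReal_le_ofReal_iff (by positivity)] at h4
  simp only [ENNReal.coe_toReal] at h4
  rw [← hp2]
  have hI : 0 ≤ ∫ x, ‖g x‖ ^ (p2 : ℝ) := integral_nonneg fun x => by positivity
  calc ∫ x, ‖g x‖ ^ (p2 : ℝ) = ((∫ x, ‖g x‖ ^ (p2 : ℝ)) ^ (p2 : ℝ)⁻¹) ^ (p2 : ℝ) := by
        rw [← Real.rpow_mul hI, inv_mul_cancel₀ hp2pos.ne', Real.rpow_one]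
    _ ≤ ((A1 * A2 * (N * N) + 1) * S) ^ (p2 : ℝ) := by
        refine Real.rpow_le_rpow (by positivity) (h4.trans ?_) hp2pos.le
        gcongr
        linarith
end hess

end part2

section part3

open scoped SchwartzMap LineDeriv Laplacian NNReal ENNReal

section Qcalc
variable {N : ℕ}

/-- rescaled Japanese bracket power -/
def Q (b c : ℝ) (x : Rn N) : ℝ := (1 + ‖c • x‖ ^ 2) ^ (-b)

lemma Q_base (c : ℝ) (x : Rn N) : 0 < 1 + ‖c • x‖ ^ 2 := by positivity

lemma Q_pos (b c : ℝ) (x : Rn N) : 0 < Q b c x := Real.rpow_pos_of_pos (Q_base c x) _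

lemma Q_le_one (b c : ℝ) (hb : 0 ≤ b) (x : Rn N) : Q b c x ≤ 1 :=
  Real.rpow_le_one_of_one_le_of_nonpos (by nlinarith [sq_nonneg ‖c • x‖]) (by linarith)

lemma Q_temperate (b c : ℝ) : (Q (N := N) b c).HasTemperateGrowth :=
  (Function.hasTemperateGrowth_one_add_norm_sq_rpow (Rn N) (-b)).comp
    (ContinuousLinearMap.hasTemperateGrowth (c • ContinuousLinearMap.id ℝ (Rn N)))

lemma Q_contDiff (b c : ℝ) {n : WithTop ℕ∞} (hn : n ≤ (⊤ : ℕ∞)) : ContDiff ℝ n (Q (N := N) b c) :=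
  (Q_temperate b c).1.of_le hn

lemma Q_cont (b c : ℝ) : Continuous (Q (N := N) b c) :=
  (Q_contDiff (n := 0) b c (by simp)).continuous

lemma Q_hasFDerivAt (b c : ℝ) (x : Rn N) :
    HasFDerivAt (Q b c) ((-2 * b * c ^ 2 * Q (b + 1) c x) • innerSL ℝ x) x := by
  have h1 : HasFDerivAt (fun y : Rn N => 1 + ‖c • y‖ ^ 2) ((2 * c ^ 2) • innerSL ℝ x) x := by
    have e : (fun y : Rn N => 1 + ‖c • y‖ ^ 2) = fun y => 1 + c ^ 2 * ‖y‖ ^ 2 := by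
      ext y; rw [norm_smul, mul_pow, Real.norm_eq_abs, sq_abs]
    rw [e]
    have h := ((hasStrictFDerivAt_norm_sq x).hasFDerivAt.const_mul (c ^ 2)).const_add 1
    refine h.congr_fderiv ?_
    ext v; simp; ring
  have h2 := h1.rpow_const (p := -b) (Or.inl (Q_base c x).ne')
  refine h2.congr_fderiv ?_
  rw [smul_smul]
  congr 1
  unfold Q
  rw [show -(b + 1) = -b - 1 by ring]
  ring

lemma Q_fderiv (b c : ℝ) (x v : Rn N) :
    fderiv ℝ (Q b c) x v = (-2 * b * c ^ 2 * Q (b + 1) c x) * inner ℝ x v := by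
  rw [(Q_hasFDerivAt b c x).fderiv]; simp

lemma Q_fderiv2 (b c : ℝ) (x v : Rn N) :
    fderiv ℝ (fun y => (-2 * b * c ^ 2 * Q (b + 1) c y) * inner ℝ y v) x v =
      -2 * b * c ^ 2 * (Q (b + 1) c x * ‖v‖ ^ 2
        - 2 * (b + 1) * c ^ 2 * Q (b + 2) c x * (inner ℝ x v) ^ 2) := by
  have h1 := (Q_hasFDerivAt (b + 1) c x).const_mul (-2 * b * c ^ 2)
  have h2 : HasFDerivAt (fun y : Rn N => inner ℝ y v) (innerSL ℝ v) x := by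
    have := (innerSL ℝ v).hasFDerivAt (x := x)
    refine this.congr_of_eventuallyEq (Filter.Eventually.of_forall fun y => ?_)
    simp [real_inner_comm]
  rw [(h1.fun_mul h2).fderiv]
  simp
  rw [show b + 1 + 1 = b + 2 by ring, ← real_inner_self_eq_norm_sq (x := v)]
  ring

/-- the value of the Laplacian of `Q` -/
def LQ (b c : ℝ) (x : Rn N) : ℝ :=
  c ^ 2 * (-2 * b * (N - 2 * b - 2) * Q (b + 1) c x - 4 * b * (b + 1) * Q (b + 2) c x)

lemma Q_sum (b c : ℝ) (x : Rn N) :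
    ∑ i, (-2 * b * c ^ 2 * (Q (b + 1) c x * ‖ee i‖ ^ 2
        - 2 * (b + 1) * c ^ 2 * Q (b + 2) c x * (inner ℝ x (ee i)) ^ 2)) = LQ b c x := by
  rw [← Finset.mul_sum, Finset.sum_sub_distrib, ← Finset.mul_sum, ← Finset.mul_sum]
  have h1 : ∑ i, (inner ℝ x (ee i)) ^ 2 = ‖x‖ ^ 2 := by
    rw [EuclideanSpace.norm_sq_eq]
    simp [EuclideanSpace.inner_single_right]
  rw [h1]
  have h2 : c ^ 2 * ‖x‖ ^ 2 * Q (b + 2) c x = Q (b + 1) c x - Q (b + 2) c x := by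
    have : Q (b + 1) c x = (1 + ‖c • x‖ ^ 2) * Q (b + 2) c x := by
      unfold Q
      rw [mul_comm, ← Real.rpow_add_one (Q_base c x).ne']
      congr 1; ring
    rw [this, norm_smul, mul_pow, Real.norm_eq_abs, sq_abs]; ring
  simp
  unfold LQ
  linear_combination (4 * b * (b + 1) * c ^ 2) * h2

lemma lap_eq_sum (f : Rn N → ℝ) (hf : ContDiff ℝ 2 f) (x : Rn N) :
    Δ f x = ∑ i, fderiv ℝ (fun y => fderiv ℝ f y (ee i)) x (ee i) := by
  rw [InnerProductSpace.laplacian_eq_iteratedFDeriv_orthonormalBasis f (EuclideanSpace.basisFun (Fin N) ℝ)]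
  refine Finset.sum_congr rfl fun i _ => ?_
  have hd : DifferentiableAt ℝ (fderiv ℝ f) x :=
      (hf.fderiv_right (m := 1) (by norm_num)).differentiable one_ne_zero x
  rw [fderiv_clm_apply hd (differentiableAt_const _), iteratedFDeriv_two_apply]
  simp

lemma lap_Q (b c : ℝ) (x : Rn N) : Δ (Q (N := N) b c) x = LQ b c x := by
  rw [lap_eq_sum _ (Q_contDiff b c (WithTop.coe_le_coe.2 le_top)), ← Q_sum]
  refine Finset.sum_congr rfl fun i _ => ?_
  simp_rw [Q_fderiv]
  exact Q_fderiv2 b c x _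

lemma temp_int (A : Rn N → ℝ) (hA : A.HasTemperateGrowth) (g : 𝓢(Rn N, ℂ)) :
    Integrable (fun x => A x • g x) := by
  have := (SchwartzMap.smulLeftCLM ℂ A g).integrable (μ := volume)
  rwa [SchwartzMap.smulLeftCLM_apply hA] at this

lemma ibp_smul (A B : Rn N → ℝ) (hA : A.HasTemperateGrowth) (hB : B.HasTemperateGrowth)
    (v : Rn N) (hAB : ∀ x, fderiv ℝ A x v = B x) (g : 𝓢(Rn N, ℂ)) :
    ∫ x, A x • dd v g x = - ∫ x, B x • g x := by
  have hdd : ∀ x, dd v g x = fderiv ℝ g x v := fun x => SchwartzMap.lineDerivOp_apply_eq_fderiv v g x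
  simp_rw [hdd, ← hAB]
  refine integral_smul_fderiv_eq_neg_fderiv_smul_of_integrable ?_ ?_ ?_ ?_ ?_
  · simp_rw [hAB]; exact temp_int B hB g
  · simp_rw [← hdd]; exact temp_int A hA _
  · exact temp_int A hA g
  · intro x _; exact hA.1.differentiable (by simp) x
  · intro x _; exact g.differentiableAt

lemma ibp_Q (b c : ℝ) (g : 𝓢(Rn N, ℂ)) :
    ∫ x, Q b c x • lapC g x = ∫ x, LQ b c x • g x := by
  have hT : ∀ v : Rn N, (fun x => (-2 * b * c ^ 2 * Q (b + 1) c x) * inner ℝ x v).HasTemperateGrowth := by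
    intro v
    exact ((Function.HasTemperateGrowth.const _).mul (Q_temperate (b + 1) c)).mul
      (Function.hasTemperateGrowth_inner_left v)
  have hT2 : ∀ v : Rn N, (fun x => -2 * b * c ^ 2 * (Q (b + 1) c x * ‖v‖ ^ 2
        - 2 * (b + 1) * c ^ 2 * Q (b + 2) c x * (inner ℝ x v) ^ 2)).HasTemperateGrowth := by
    intro v
    refine (Function.HasTemperateGrowth.const _).mul
      (((Q_temperate (b + 1) c).mul (Function.HasTemperateGrowth.const _)).sub
      (((Function.HasTemperateGrowth.const _).mul (Q_temperate (b + 2) c)).mul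
      ((Function.hasTemperateGrowth_inner_left v).pow 2)))
  simp_rw [schwartz_lap, ← Q_sum, Finset.smul_sum, Finset.sum_smul]
  rw [integral_finsetSum _ fun i _ => temp_int _ (Q_temperate b c) _,
    integral_finsetSum _ fun i _ => temp_int _ (hT2 (ee i)) _]
  refine Finset.sum_congr rfl fun i _ => ?_
  rw [ibp_smul _ _ (Q_temperate b c) (hT (ee i)) _ (fun x => Q_fderiv b c x _),
    ibp_smul _ _ (hT (ee i)) (hT2 (ee i)) _ (fun x => Q_fderiv2 b c x _), neg_neg]
end Qcalc

end part3

section part4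

open scoped SchwartzMap LineDeriv Laplacian NNReal ENNReal

section Wfacts
variable {N : ℕ}

def aN (N : ℕ) : ℝ := ((N : ℝ) - 4) / 2
def sN (N : ℕ) : ℝ := 8 / ((N : ℝ) - 4)
def KN (N : ℕ) : ℝ := (N : ℝ) * ((N : ℝ) - 4) * ((N : ℝ) ^ 2 - 4)
def CN (N : ℕ) : ℝ := KN N ^ (((N : ℝ) - 4) / 8)

def WL (l : ℝ) (x : Rn N) : ℝ := CN N * l ^ (-aN N) * Q (aN N) l⁻¹ x
def LW (l : ℝ) (x : Rn N) : ℝ := CN N * l ^ (-aN N) * LQ (aN N) l⁻¹ x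

lemma castN (hN : 13 ≤ N) : (13 : ℝ) ≤ N := by exact_mod_cast hN

lemma aN_ge (hN : 13 ≤ N) : 9 / 2 ≤ aN N := by
  have := castN hN; unfold aN; linarith

lemma N_eq : (N : ℝ) = 2 * aN N + 4 := by unfold aN; ring

lemma sN_mul (hN : 13 ≤ N) : sN N * aN N = 4 := by
  have := castN hN
  unfold sN aN
  have : (N : ℝ) - 4 ≠ 0 := by linarith
  field_simp; norm_num

lemma sN_pos (hN : 13 ≤ N) : 0 < sN N := by
  have := castN hN; unfold sN; apply div_pos <;> linarith

lemma sN_le (hN : 13 ≤ N) : sN N ≤ 1 := by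
  have := castN hN; unfold sN; rw [div_le_one (by linarith)]; linarith

lemma q_eq (hN : 13 ≤ N) : 2 * (N : ℝ) / ((N : ℝ) - 4) = sN N + 2 := by
  have := castN hN
  have : (N : ℝ) - 4 ≠ 0 := by linarith
  unfold sN
  field_simp; ring

lemma KN_pos (hN : 13 ≤ N) : 0 < KN N := by
  have := castN hN
  have h2 : 0 < (N : ℝ) - 4 := by linarith
  have h3 : 0 < (N : ℝ) ^ 2 - 4 := by nlinarith
  unfold KN; positivity

lemma CN_pos (hN : 13 ≤ N) : 0 < CN N := Real.rpow_pos_of_pos (KN_pos hN) _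

lemma CN_s (hN : 13 ≤ N) : CN N ^ sN N = KN N := by
  have := castN hN
  have : (N : ℝ) - 4 ≠ 0 := by linarith
  unfold CN
  rw [← Real.rpow_mul (KN_pos hN).le, show ((N : ℝ) - 4) / 8 * sN N = 1 by
    unfold sN; field_simp, Real.rpow_one]

lemma Q_scale (b c : ℝ) (x : Rn N) : Q b c x = Q b 1 (c • x) := by simp [Q]

lemma Q_rpow (b c e : ℝ) (x : Rn N) : Q b c x ^ e = Q (e * b) c x := by
  unfold Q; rw [← Real.rpow_mul (Q_base c x).le]; congr 1; ring

lemma WL_pos (hN : 13 ≤ N) {l : ℝ} (hl : 0 < l) (x : Rn N) : 0 < WL l x := by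
  have := CN_pos hN
  have := Real.rpow_pos_of_pos hl (-aN N)
  have := Q_pos (aN N) l⁻¹ x
  unfold WL; positivity

lemma resc_eq (l : ℝ) (x : Rn N) : rescR l (Wfun N) x = WL l x := by
  unfold rescR Wfun WL CN KN Q aN; ring

lemma Wfun_eq (x : Rn N) : Wfun N x = WL 1 x := by
  unfold Wfun WL CN KN Q aN; simp

lemma LQ_a (c : ℝ) (x : Rn N) : LQ (aN N) c x =
    c ^ 2 * (-4 * aN N * Q (aN N + 1) c x - 4 * aN N * (aN N + 1) * Q (aN N + 2) c x) := by
  unfold LQ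
  have := N_eq (N := N)
  rw [show (N : ℝ) - 2 * aN N - 2 = 2 by linarith]; ring

lemma WL_cont (l : ℝ) : Continuous (WL (N := N) l) := by
  unfold WL; exact continuous_const.mul (Q_cont _ _)

lemma LW_cont (l : ℝ) : Continuous (LW (N := N) l) := by
  unfold LW LQ
  have := Q_cont (N := N) (aN N + 1) l⁻¹
  have := Q_cont (N := N) (aN N + 2) l⁻¹
  fun_prop

lemma WL_contDiff (l : ℝ) : ContDiff ℝ 2 (WL (N := N) l) := by
  unfold WL; exact contDiff_const.mul (Q_contDiff _ _ (WithTop.coe_le_coe.2 le_top))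

lemma lap_WL (l : ℝ) (x : Rn N) : Δ (WL (N := N) l) x = LW l x := by
  have : WL (N := N) l = (CN N * l ^ (-aN N)) • Q (aN N) l⁻¹ := by
    ext y; simp [WL]
  rw [this, InnerProductSpace.laplacian_smul _ ((Q_contDiff _ _ (WithTop.coe_le_coe.2 le_top)).contDiffAt), lap_Q, LW]; simp

lemma zW_contDiff (z : ℂ) (l : ℝ) : ContDiff ℝ 2 (fun x : Rn N => z * (WL l x : ℂ)) :=
  contDiff_const.mul (Complex.ofRealCLM.contDiff.comp (WL_contDiff l))

lemma lap_zW (z : ℂ) (l : ℝ) (x : Rn N) :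
    lapC (fun x : Rn N => z * (WL l x : ℂ)) x = z * (LW l x : ℂ) := by
  rw [lapC_eq]
  have := ((WL_contDiff (N := N) l).contDiffAt (x := x)).laplacian_CLM_comp_left
    (l := (ContinuousLinearMap.mul ℝ ℂ z).comp Complex.ofRealCLM)
  refine this.trans ?_
  show z * ((Δ (WL (N := N) l) x : ℝ) : ℂ) = _
  rw [lap_WL]

lemma lap_sum (z w : ℂ) (l m : ℝ) (g : 𝓢(Rn N, ℂ)) (x : Rn N) :
    lapC (fun x : Rn N => z * (WL l x : ℂ) + w * (WL m x : ℂ) + g x) x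
      = z * (LW l x : ℂ) + w * (LW m x : ℂ) + lapC g x := by
  rw [← lap_zW, ← lap_zW]
  simp only [lapC_eq]
  have h1 := (zW_contDiff (N := N) z l).contDiffAt (x := x)
  have h2 := (zW_contDiff (N := N) w m).contDiffAt (x := x)
  have h3 : ContDiffAt ℝ 2 g x := (g.smooth 2).contDiffAt
  have e1 := (h1.add h2).laplacian_add h3
  have e2 := h1.laplacian_add h2
  refine e1.trans ?_
  exact congrArg (· + Δ (⇑g) x) e2

/-- the nonlinear elliptic equation, tested against a Schwartz function -/
lemma W_eqn (hN : 13 ≤ N) {l : ℝ} (hl : 0 < l) (x : Rn N) :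
    WL l x ^ (sN N + 1) = CN N * l ^ (-aN N) * (KN N * l⁻¹ ^ 4 * Q (aN N + 4) l⁻¹ x) := by
  have hC := CN_pos hN
  have hlp := Real.rpow_pos_of_pos hl (-aN N)
  have hQ := Q_pos (aN N) l⁻¹ x
  have hs := sN_mul hN
  rw [Real.rpow_add_one (WL_pos hN hl x).ne']
  have e1 : WL l x ^ sN N = KN N * l⁻¹ ^ 4 * Q 4 l⁻¹ x := by
    unfold WL
    rw [Real.mul_rpow (by positivity) hQ.le, Real.mul_rpow hC.le hlp.le, CN_s hN, Q_rpow, hs,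
      ← Real.rpow_mul hl.le, show -aN N * sN N = -4 by linarith, Real.rpow_neg hl.le, inv_pow]
    norm_num
  rw [e1]
  have e2 : Q (aN N + 4) l⁻¹ x = Q (aN N) l⁻¹ x * Q 4 l⁻¹ x := by
    unfold Q
    rw [← Real.rpow_add (Q_base _ _)]; congr 1; ring
  rw [e2]; unfold WL; ring

lemma ibp_W (hN : 13 ≤ N) {l : ℝ} (hl : 0 < l) (g : 𝓢(Rn N, ℂ)) :
    ∫ x, LW l x • lapC g x = ∫ x, (WL l x ^ (sN N + 1)) • g x := by
  set c := l⁻¹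
  set a := aN N with ha
  have hNa := N_eq (N := N)
  have i1 : ∀ b, Integrable (fun x => Q b c x • lapC g x) := by
    intro b
    have : (fun x => Q b c x • lapC g x) = fun x => Q b c x • (∑ i, dd (ee i) (dd (ee i) g)) x := by
      ext x; rw [schwartz_lap]; simp
    rw [this]
    exact temp_int _ (Q_temperate b c) _
  have i2 : ∀ b, Integrable (fun x => Q b c x • g x) := fun b => temp_int _ (Q_temperate b c) g
  have e1 := ibp_Q (a + 1) c g
  have e2 := ibp_Q (a + 2) c g
  have l1 : ∀ x : Rn N, LQ (a + 1) c x = (-4 * (a + 1) * (a + 2) * c ^ 2) * Q (a + 3) c x := by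
    intro x; unfold LQ
    rw [hNa, show a + 1 + 1 = a + 2 by ring, show a + 1 + 2 = a + 3 by ring]; ring
  have l2 : ∀ x : Rn N, LQ (a + 2) c x = (4 * (a + 2) * c ^ 2) * Q (a + 3) c x
      + (-4 * (a + 2) * (a + 3) * c ^ 2) * Q (a + 4) c x := by
    intro x; unfold LQ
    rw [hNa, show a + 2 + 1 = a + 3 by ring, show a + 2 + 2 = a + 4 by ring]; ring
  have lin : ∀ (k1 k2 b1 b2 : ℝ) (h : Rn N → ℂ), (∀ b, Integrable (fun x => Q b c x • h x)) →
      ∫ x, (k1 * Q b1 c x + k2 * Q b2 c x) • h x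
        = k1 • (∫ x, Q b1 c x • h x) + k2 • ∫ x, Q b2 c x • h x := by
    intro k1 k2 b1 b2 h hh
    rw [← integral_smul, ← integral_smul]
    refine Eq.trans ?_ (integral_add ((hh b1).smul k1) ((hh b2).smul k2))
    refine integral_congr_ae (Filter.Eventually.of_forall fun x => ?_)
    simp only [add_smul, mul_smul, Pi.smul_apply]
  have L1 : ∀ x : Rn N, LW l x = (CN N * l ^ (-a) * (c ^ 2 * (-4 * a))) * Q (a + 1) c x
      + (CN N * l ^ (-a) * (c ^ 2 * (-4 * a * (a + 1)))) * Q (a + 2) c x := by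
    intro x; unfold LW; rw [LQ_a]; ring
  have R1 : ∀ x : Rn N, WL l x ^ (sN N + 1) = (CN N * l ^ (-a) * (KN N * c ^ 4)) * Q (a + 4) c x := by
    intro x; rw [W_eqn hN hl]; ring
  have l1' : ∫ x, LQ (a + 1) c x • g x = (-4 * (a + 1) * (a + 2) * c ^ 2) • ∫ x, Q (a + 3) c x • g x := by
    simp only [l1, mul_smul _ (Q _ _ _)]; rw [integral_smul]
  have l3' : ∫ x, WL l x ^ (sN N + 1) • g x = (CN N * l ^ (-a) * (KN N * c ^ 4)) • ∫ x, Q (a + 4) c x • g x := by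
    simp only [R1, mul_smul _ (Q _ _ _)]; rw [integral_smul]
  rw [l3']
  simp only [L1]
  rw [lin _ _ _ _ _ i1, e1, e2, l1']
  simp only [l2]
  rw [lin _ _ _ _ _ i2]
  have hK : KN N = 16 * a * (a + 1) * (a + 2) * (a + 3) := by
    unfold KN; rw [hNa]; ring
  rw [hK]
  generalize (∫ x, Q (a + 3) c x • g x) = A
  generalize (∫ x, Q (a + 4) c x • g x) = B
  simp only [Complex.real_smul]
  push_cast
  ring

/-! scaling -/

lemma scale_int (f : Rn N → ℝ) (e : ℝ) {l : ℝ} (hl : 0 < l) :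
    ∫ x, l ^ (-e) * f (l⁻¹ • x) = l ^ ((N : ℝ) - e) * ∫ x, f x := by
  rw [integral_const_mul, Measure.integral_comp_inv_smul_of_nonneg _ _ hl.le]
  rw [Real.rpow_sub hl, Real.rpow_neg hl.le]
  simp
  field_simp

lemma WL_scale (l : ℝ) (x : Rn N) : WL l x = l ^ (-aN N) * WL 1 (l⁻¹ • x) := by
  unfold WL; rw [Q_scale _ l⁻¹]; simp; ring

lemma LW_scale {l : ℝ} (hl : 0 < l) (x : Rn N) : LW l x = l ^ (-(aN N + 2)) * LW 1 (l⁻¹ • x) := by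
  unfold LW LQ
  rw [Q_scale _ l⁻¹, Q_scale _ l⁻¹, neg_add, Real.rpow_add hl, Real.rpow_neg hl.le 2]
  simp; ring

lemma WL_rpow_scale (hN : 13 ≤ N) {l : ℝ} (hl : 0 < l) (e : ℝ) (x : Rn N) :
    WL l x ^ e = l ^ (-(e * aN N)) * (fun y => WL 1 y ^ e) (l⁻¹ • x) := by
  rw [WL_scale, Real.mul_rpow (by positivity) (WL_pos hN one_pos _).le, ← Real.rpow_mul hl.le]
  congr 2; ring

lemma WL_int_scale (hN : 13 ≤ N) {l : ℝ} (hl : 0 < l) (e : ℝ) :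
    ∫ x : Rn N, WL l x ^ e = l ^ ((N : ℝ) - e * aN N) * ∫ x : Rn N, WL 1 x ^ e := by
  simp_rw [WL_rpow_scale hN hl]
  rw [scale_int (fun y => WL 1 y ^ e) _ hl]

lemma LW_int_scale {l : ℝ} (hl : 0 < l) :
    ∫ x : Rn N, LW l x ^ 2 = ∫ x : Rn N, LW 1 x ^ 2 := by
  have : ∀ x : Rn N, LW l x ^ 2 = l ^ (-(N : ℝ)) * (fun y => LW 1 y ^ 2) (l⁻¹ • x) := by
    intro x
    rw [LW_scale hl, mul_pow, ← Real.rpow_natCast, ← Real.rpow_mul hl.le]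
    congr 2
    rw [N_eq (N := N)]; push_cast; ring
  simp_rw [this]
  rw [scale_int (fun y => LW 1 y ^ 2) _ hl]; simp

lemma Q_int {b : ℝ} (hb : (N : ℝ) < 2 * b) {c : ℝ} (hc : 0 < c) : Integrable (Q (N := N) b c) := by
  have h : Integrable (fun x : Rn N => Q b 1 x) := by
    have := integrable_rpow_neg_one_add_norm_sq (E := Rn N) (μ := volume) (r := 2 * b) (by simpa using hb)
    refine this.congr (Filter.Eventually.of_forall fun x => ?_)
    simp [Q]
    congr 1; ring
  have := h.comp_smul (R := c) hc.ne'
  refine this.congr (Filter.Eventually.of_forall fun x => ?_)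
  exact (Q_scale b c x).symm

lemma WL_rpow (hN : 13 ≤ N) {l : ℝ} (hl : 0 < l) (e : ℝ) (x : Rn N) :
    WL l x ^ e = (CN N * l ^ (-aN N)) ^ e * Q (e * aN N) l⁻¹ x := by
  unfold WL
  have hC := CN_pos hN
  rw [Real.mul_rpow (by positivity) (Q_pos _ _ _).le, Q_rpow]

lemma WL_int (hN : 13 ≤ N) {l : ℝ} (hl : 0 < l) {e : ℝ} (he : (N : ℝ) < 2 * (e * aN N)) :
    Integrable (fun x : Rn N => WL l x ^ e) := by
  simp_rw [WL_rpow hN hl]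
  exact (Q_int he (inv_pos.2 hl)).const_mul _

lemma Q_mono {b b' c : ℝ} (h : b ≤ b') (x : Rn N) : Q b' c x ≤ Q b c x :=
  Real.rpow_le_rpow_of_exponent_le (by nlinarith [sq_nonneg ‖c • x‖]) (by linarith)

/-- pointwise size of `LW` -/
lemma LW_le (hN : 13 ≤ N) {l : ℝ} (hl : 0 < l) (x : Rn N) :
    |LW l x| ≤ (8 * aN N * (aN N + 1) * CN N) * (l ^ (-(aN N + 2)) * Q (aN N + 1) l⁻¹ x) := by
  have ha := aN_ge hN
  have hC := CN_pos hN
  have h1 := Q_pos (aN N + 1) l⁻¹ x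
  have h2 := Q_pos (aN N + 2) l⁻¹ x
  have h3 := Q_mono (c := l⁻¹) (show aN N + 1 ≤ aN N + 2 by linarith) x
  have hl2 : l ^ (-(aN N + 2)) = l ^ (-aN N) * l⁻¹ ^ 2 := by
    rw [neg_add, Real.rpow_add hl, Real.rpow_neg hl.le 2]; simp
  have : LW l x = -((4 * aN N * CN N) * l ^ (-(aN N + 2)) * (Q (aN N + 1) l⁻¹ x + (aN N + 1) * Q (aN N + 2) l⁻¹ x)) := by
    unfold LW; rw [LQ_a, hl2]; ring
  rw [this, abs_neg, abs_of_nonneg (by positivity)]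
  have h4 : Q (aN N + 1) l⁻¹ x + (aN N + 1) * Q (aN N + 2) l⁻¹ x ≤ 2 * (aN N + 1) * Q (aN N + 1) l⁻¹ x := by
    nlinarith
  calc _ ≤ (4 * aN N * CN N) * l ^ (-(aN N + 2)) * (2 * (aN N + 1) * Q (aN N + 1) l⁻¹ x) := by gcongr
    _ = _ := by ring

lemma LW_sq_int (hN : 13 ≤ N) {l : ℝ} (hl : 0 < l) : Integrable (fun x : Rn N => LW l x ^ 2) := by
  have ha := aN_ge hN
  have := (Q_int (N := N) (b := 2 * (aN N + 1)) (by rw [N_eq (N := N)]; linarith) (inv_pos.2 hl)).const_mul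
    (((8 * aN N * (aN N + 1) * CN N) * l ^ (-(aN N + 2))) ^ 2)
  refine this.mono' ((LW_cont l).pow 2).aestronglyMeasurable (Filter.Eventually.of_forall fun x => ?_)
  rw [Real.norm_eq_abs, abs_pow]
  calc |LW l x| ^ 2 ≤ _ := pow_le_pow_left₀ (abs_nonneg _) (LW_le hN hl x) 2
    _ = _ := by
      rw [← Q_rpow, ← mul_assoc, mul_pow]; norm_num

lemma Q_decay {b l : ℝ} (hb : 0 ≤ b) (hl : 0 < l) {x : Rn N} (hx : x ≠ 0) :
    Q b l⁻¹ x ≤ l ^ (2 * b) * ‖x‖ ^ (-(2 * b)) := by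
  have hx' := norm_pos_iff.2 hx
  have h1 : 0 < ‖l⁻¹ • x‖ := norm_pos_iff.2 (smul_ne_zero (inv_pos.2 hl).ne' hx)
  calc Q b l⁻¹ x ≤ (‖l⁻¹ • x‖ ^ 2) ^ (-b) :=
        Real.rpow_le_rpow_of_nonpos (by positivity) (by linarith) (by linarith)
    _ = ‖l⁻¹ • x‖ ^ (-(2 * b)) := by
        rw [← Real.rpow_natCast, ← Real.rpow_mul h1.le]; congr 1; push_cast; ring
    _ = _ := by
        rw [norm_smul, Real.norm_of_nonneg (inv_pos.2 hl).le, Real.mul_rpow (inv_pos.2 hl).le hx'.le,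
          Real.inv_rpow hl.le, ← Real.rpow_neg hl.le, neg_neg]

lemma Q_near {b m : ℝ} (hb : 0 ≤ b) (hm : 0 < m) (hm2 : m ≤ 2) (x : Rn N) :
    Q b m⁻¹ x ≤ 4 ^ b * Q b 1 x := by
  have hi : 1 / 2 ≤ m⁻¹ := by rw [one_div]; exact inv_anti₀ hm hm2
  have h1 : ((1 + ‖(1:ℝ) • x‖ ^ 2) / 4) ≤ 1 + ‖m⁻¹ • x‖ ^ 2 := by
    rw [norm_smul, norm_smul, Real.norm_of_nonneg (by linarith : 0 ≤ m⁻¹), norm_one, one_mul, mul_pow]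
    have : (1 / 4) * ‖x‖ ^ 2 ≤ m⁻¹ ^ 2 * ‖x‖ ^ 2 := by gcongr; nlinarith
    linarith
  calc Q b m⁻¹ x ≤ ((1 + ‖(1:ℝ) • x‖ ^ 2) / 4) ^ (-b) :=
        Real.rpow_le_rpow_of_nonpos (by positivity) h1 (by linarith)
    _ = _ := by
        unfold Q
        rw [Real.div_rpow (by positivity) (by norm_num), Real.rpow_neg (by norm_num : (0:ℝ) ≤ 4)]
        field_simp

/-- the dominating singular function -/
def JJ (x : Rn N) : ℝ := ‖x‖ ^ (-(2 * aN N + 2)) * Q (aN N + 1) 1 x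

lemma JJ_nonneg (x : Rn N) : 0 ≤ JJ x := mul_nonneg (by positivity) (Q_pos _ _ _).le

lemma JJ_int (hN : 13 ≤ N) : Integrable (JJ (N := N)) := by
  have ha := aN_ge hN
  have : Nontrivial (Rn N) := by
    have : Nonempty (Fin N) := ⟨⟨0, by omega⟩⟩
    infer_instance
  have key := integrable_fun_norm_addHaar (E := Rn N) (F := ℝ) (volume)
    (f := fun y : ℝ => y ^ (-(2 * aN N + 2)) * (1 + y ^ 2) ^ (-(aN N + 1)))
  have e : (fun x : Rn N => (fun y : ℝ => y ^ (-(2 * aN N + 2)) * (1 + y ^ 2) ^ (-(aN N + 1))) ‖x‖) = JJ := by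
    ext x; simp [JJ, Q]
  rw [e] at key
  rw [key]
  have h1 := integrable_rpow_neg_one_add_norm_sq (E := ℝ) (μ := volume) (r := 2 * aN N + 1) (by simp; linarith)
  refine h1.integrableOn.mono' ?_ ?_
  · apply Measurable.aestronglyMeasurable; fun_prop
  · filter_upwards [ae_restrict_mem measurableSet_Ioi] with y hy
    have hy : 0 < y := hy
    have hf : Module.finrank ℝ (Rn N) = N := by simp
    rw [hf]
    have hp : y ^ (N - 1) = y ^ ((N : ℝ) - 1) := by
      rw [← Real.rpow_natCast, Nat.cast_sub (by omega)]; simp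
    rw [smul_eq_mul, ← mul_assoc, hp, ← Real.rpow_add hy, show (N : ℝ) - 1 + -(2 * aN N + 2) = 1 by
      rw [N_eq]; ring, Real.rpow_one, Real.norm_of_nonneg (by positivity)]
    have hb : 0 < 1 + y ^ 2 := by positivity
    have h2 : y ≤ (1 + y ^ 2) ^ (1 / 2 : ℝ) := by
      rw [← Real.sqrt_eq_rpow]; exact Real.le_sqrt_of_sq_le (by linarith)
    calc y * (1 + y ^ 2) ^ (-(aN N + 1)) ≤ (1 + y ^ 2) ^ (1 / 2 : ℝ) * (1 + y ^ 2) ^ (-(aN N + 1)) := by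
          gcongr
      _ = _ := by
          rw [← Real.rpow_add hb, Real.norm_of_nonneg hy.le]; congr 1; ring

end Wfacts

end part4

section part5

open scoped SchwartzMap LineDeriv Laplacian NNReal ENNReal

section Bounds
variable {N : ℕ}

lemma rpow_neg_le_two {m : ℝ} (hm : 1 / 2 ≤ m) {e : ℝ} (he : 0 ≤ e) : m ^ (-e) ≤ 2 ^ e := by
  have : m ^ (-e) ≤ (1 / 2 : ℝ) ^ (-e) :=
    Real.rpow_le_rpow_of_nonpos (by norm_num) hm (by linarith)
  refine this.trans_eq ?_
  rw [one_div, Real.inv_rpow (by norm_num), Real.rpow_neg (by norm_num), inv_inv]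

/-- a uniform constant bounding `WL m` and `LW m` near `m = 1` -/
lemma WL_near (hN : 13 ≤ N) : ∃ M : ℝ, 0 < M ∧ ∀ m : ℝ, 1 / 2 ≤ m → m ≤ 2 → ∀ x : Rn N,
    WL m x ≤ M * Q (aN N) 1 x ∧ |LW m x| ≤ M * Q (aN N + 1) 1 x := by
  have ha := aN_ge hN
  have hC := CN_pos hN
  refine ⟨CN N * (2 ^ aN N * 4 ^ aN N) + (8 * aN N * (aN N + 1) * CN N) * (2 ^ (aN N + 2) * 4 ^ (aN N + 1)),
    by positivity, fun m h1 h2 x => ⟨?_, ?_⟩⟩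
  · have hm : 0 < m := by linarith
    have hq := Q_pos (aN N) 1 x
    calc WL m x = CN N * (m ^ (-aN N) * Q (aN N) m⁻¹ x) := by unfold WL; ring
      _ ≤ CN N * (2 ^ aN N * (4 ^ aN N * Q (aN N) 1 x)) := by
          gcongr
          · exact (Q_pos _ _ _).le
          · exact rpow_neg_le_two h1 (by linarith)
          · exact Q_near (by linarith) hm h2 x
      _ = (CN N * (2 ^ aN N * 4 ^ aN N)) * Q (aN N) 1 x := by ring
      _ ≤ _ := by
          gcongr
          have : 0 ≤ (8 * aN N * (aN N + 1) * CN N) * (2 ^ (aN N + 2) * 4 ^ (aN N + 1)) := by positivity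
          linarith
  · have hm : 0 < m := by linarith
    have hq := Q_pos (aN N + 1) 1 x
    calc |LW m x| ≤ _ := LW_le hN hm x
      _ ≤ (8 * aN N * (aN N + 1) * CN N) * (2 ^ (aN N + 2) * (4 ^ (aN N + 1) * Q (aN N + 1) 1 x)) := by
          gcongr
          · exact (Q_pos _ _ _).le
          · exact rpow_neg_le_two h1 (by linarith)
          · exact Q_near (by linarith) hm h2 x
      _ = ((8 * aN N * (aN N + 1) * CN N) * (2 ^ (aN N + 2) * 4 ^ (aN N + 1))) * Q (aN N + 1) 1 x := by ring
      _ ≤ _ := by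
          gcongr
          have : 0 ≤ CN N * (2 ^ aN N * 4 ^ aN N) := by positivity
          linarith

lemma WL_far (hN : 13 ≤ N) {l : ℝ} (hl : 0 < l) {x : Rn N} (hx : x ≠ 0) :
    WL l x ≤ CN N * (l ^ aN N * ‖x‖ ^ (-(2 * aN N))) := by
  have ha := aN_ge hN
  have hC := CN_pos hN
  have hlp := Real.rpow_pos_of_pos hl (-aN N)
  calc WL l x = CN N * (l ^ (-aN N) * Q (aN N) l⁻¹ x) := by unfold WL; ring
    _ ≤ CN N * (l ^ (-aN N) * (l ^ (2 * aN N) * ‖x‖ ^ (-(2 * aN N)))) := by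
        gcongr; exact Q_decay (by linarith) hl hx
    _ = _ := by
        rw [← mul_assoc (l ^ _), ← Real.rpow_add hl]; congr 3; ring

lemma LW_far (hN : 13 ≤ N) {l : ℝ} (hl : 0 < l) {x : Rn N} (hx : x ≠ 0) :
    |LW l x| ≤ (8 * aN N * (aN N + 1) * CN N) * (l ^ aN N * ‖x‖ ^ (-(2 * aN N + 2))) := by
  have ha := aN_ge hN
  have hC := CN_pos hN
  have hlp := Real.rpow_pos_of_pos hl (-(aN N + 2))
  refine (LW_le hN hl x).trans (mul_le_mul_of_nonneg_left ?_ (by positivity))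
  calc l ^ (-(aN N + 2)) * Q (aN N + 1) l⁻¹ x
      ≤ l ^ (-(aN N + 2)) * (l ^ (2 * (aN N + 1)) * ‖x‖ ^ (-(2 * (aN N + 1)))) := by
        gcongr; exact Q_decay (by linarith) hl hx
    _ = _ := by
        rw [← mul_assoc, ← Real.rpow_add hl]; congr 2 <;> ring

lemma ae_ne (hN : 13 ≤ N) : ∀ᵐ x : Rn N, x ≠ 0 := by
  have : Nontrivial (Rn N) := by
    have : Nonempty (Fin N) := ⟨⟨0, by omega⟩⟩
    infer_instance
  exact compl_mem_ae_iff.2 (measure_singleton 0)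

lemma G1 (hN : 13 ≤ N) : ∃ K : ℝ, 0 < K ∧ ∀ m l : ℝ, 1 / 2 ≤ m → m ≤ 2 → 0 < l →
    ∫ x : Rn N, |LW m x * LW l x| ≤ K * l ^ aN N := by
  obtain ⟨M, hM, hW⟩ := WL_near hN
  have ha := aN_ge hN
  have hC := CN_pos hN
  set B := 8 * aN N * (aN N + 1) * CN N
  have hB : 0 < B := by positivity
  have hJ : 0 ≤ ∫ x : Rn N, JJ x := integral_nonneg JJ_nonneg
  refine ⟨M * B * (∫ x : Rn N, JJ x) + 1, by positivity, fun m l h1 h2 hl => ?_⟩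
  have hlp := Real.rpow_pos_of_pos hl (aN N)
  calc ∫ x : Rn N, |LW m x * LW l x| ≤ ∫ x : Rn N, (M * B * l ^ aN N) * JJ x := by
        refine integral_mono_of_nonneg (Filter.Eventually.of_forall fun x => abs_nonneg _)
          ((JJ_int hN).const_mul _) ?_
        filter_upwards [ae_ne hN] with x hx
        rw [abs_mul]
        have := mul_le_mul (hW m h1 h2 x).2 (LW_far hN hl hx) (abs_nonneg _)
          (mul_nonneg hM.le (Q_pos _ _ _).le)
        refine this.trans_eq ?_
        unfold JJ; ring
    _ = M * B * l ^ aN N * ∫ x : Rn N, JJ x := integral_const_mul _ _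
    _ ≤ _ := by nlinarith

lemma JJ_dom (hN : 13 ≤ N) {x : Rn N} (hx : x ≠ 0) :
    ‖x‖ ^ (-(2 * aN N)) * Q (aN N + 4) 1 x ≤ JJ x := by
  have hx' := norm_pos_iff.2 hx
  have e1 : ‖x‖ ^ (-(2 * aN N)) = ‖x‖ ^ (-(2 * aN N + 2)) * ‖x‖ ^ 2 := by
    rw [← Real.rpow_natCast ‖x‖ 2, ← Real.rpow_add hx']; congr 1; push_cast; ring
  have e2 : Q (aN N + 3) 1 x = (1 + ‖(1:ℝ) • x‖ ^ 2) * Q (aN N + 4) 1 x := by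
    unfold Q
    rw [mul_comm, ← Real.rpow_add_one (Q_base 1 x).ne']; congr 1; ring
  have e3 := Q_mono (c := 1) (show aN N + 1 ≤ aN N + 3 by linarith) x
  have e4 := Q_pos (aN N + 4) 1 x
  rw [one_smul] at e2
  unfold JJ
  rw [e1, mul_assoc]
  gcongr
  nlinarith

lemma G2 (hN : 13 ≤ N) : ∃ K : ℝ, 0 < K ∧ ∀ m l : ℝ, 1 / 2 ≤ m → m ≤ 2 → 0 < l →
    Integrable (fun x : Rn N => WL m x ^ (sN N + 1) * WL l x) ∧
    ∫ x : Rn N, WL m x ^ (sN N + 1) * WL l x ≤ K * l ^ aN N := by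
  obtain ⟨M, hM, hW⟩ := WL_near hN
  have ha := aN_ge hN
  have hs := sN_pos hN
  have hC := CN_pos hN
  have hJ : 0 ≤ ∫ x : Rn N, JJ x := integral_nonneg JJ_nonneg
  refine ⟨M ^ (sN N + 1) * CN N * (∫ x : Rn N, JJ x) + 1, by positivity, fun m l h1 h2 hl => ?_⟩
  have hm : 0 < m := by linarith
  have hlp := Real.rpow_pos_of_pos hl (aN N)
  have dom : ∀ᵐ x : Rn N, WL m x ^ (sN N + 1) * WL l x ≤ (M ^ (sN N + 1) * CN N * l ^ aN N) * JJ x := by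
    filter_upwards [ae_ne hN] with x hx
    have b1 : WL m x ^ (sN N + 1) ≤ M ^ (sN N + 1) * Q (aN N + 4) 1 x := by
      refine (Real.rpow_le_rpow (WL_pos hN hm x).le (hW m h1 h2 x).1 (by linarith)).trans_eq ?_
      rw [Real.mul_rpow hM.le (Q_pos _ _ _).le, Q_rpow]
      congr 2
      linarith [sN_mul hN]
    have := Q_pos (aN N + 4) 1 x
    calc WL m x ^ (sN N + 1) * WL l x
        ≤ (M ^ (sN N + 1) * Q (aN N + 4) 1 x) * (CN N * (l ^ aN N * ‖x‖ ^ (-(2 * aN N)))) :=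
          mul_le_mul b1 (WL_far hN hl hx) (WL_pos hN hl x).le (by positivity)
      _ = (M ^ (sN N + 1) * CN N * l ^ aN N) * (‖x‖ ^ (-(2 * aN N)) * Q (aN N + 4) 1 x) := by ring
      _ ≤ _ := by gcongr; exact JJ_dom hN hx
  have nn : ∀ x : Rn N, 0 ≤ WL m x ^ (sN N + 1) * WL l x := fun x =>
    mul_nonneg (Real.rpow_nonneg (WL_pos hN hm x).le _) (WL_pos hN hl x).le
  have hI : Integrable (fun x : Rn N => WL m x ^ (sN N + 1) * WL l x) := by
    refine ((JJ_int hN).const_mul (M ^ (sN N + 1) * CN N * l ^ aN N)).mono'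
      (((WL_cont m).rpow_const fun x => Or.inl (WL_pos hN hm x).ne').mul (WL_cont l)).aestronglyMeasurable ?_
    filter_upwards [dom] with x hx
    rwa [Real.norm_of_nonneg (nn x)]
  refine ⟨hI, ?_⟩
  calc _ ≤ ∫ x : Rn N, (M ^ (sN N + 1) * CN N * l ^ aN N) * JJ x :=
        integral_mono_ae hI ((JJ_int hN).const_mul _) dom
    _ = (M ^ (sN N + 1) * CN N * l ^ aN N) * ∫ x : Rn N, JJ x := integral_const_mul _ _
    _ ≤ _ := by nlinarith

/-- generic bound: bounded factor in `WL m`, integrable power of `WL l` -/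
lemma G3 (hN : 13 ≤ N) (α β : ℝ) (hα : 0 ≤ α) (hβ : (N : ℝ) < 2 * (β * aN N)) :
    ∃ K : ℝ, 0 < K ∧ ∀ m l : ℝ, 1 / 2 ≤ m → m ≤ 2 → 0 < l →
    Integrable (fun x : Rn N => WL m x ^ α * WL l x ^ β) ∧
    ∫ x : Rn N, WL m x ^ α * WL l x ^ β ≤ K * l ^ ((N : ℝ) - β * aN N) := by
  obtain ⟨M, hM, hW⟩ := WL_near hN
  have ha := aN_ge hN
  have hJ : 0 ≤ ∫ x : Rn N, WL 1 x ^ β := integral_nonneg fun x => Real.rpow_nonneg (WL_pos hN one_pos x).le _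
  refine ⟨M ^ α * (∫ x : Rn N, WL 1 x ^ β) + 1, by positivity, fun m l h1 h2 hl => ?_⟩
  have hm : 0 < m := by linarith
  have hlp := Real.rpow_pos_of_pos hl ((N : ℝ) - β * aN N)
  have dom : ∀ x : Rn N, WL m x ^ α * WL l x ^ β ≤ M ^ α * WL l x ^ β := by
    intro x
    have := Real.rpow_nonneg (WL_pos hN hl x).le β
    gcongr
    · exact (WL_pos hN hm x).le
    · refine (hW m h1 h2 x).1.trans ?_
      have := Q_le_one (aN N) 1 (by linarith) x
      nlinarith
  have nn : ∀ x : Rn N, 0 ≤ WL m x ^ α * WL l x ^ β := fun x =>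
    mul_nonneg (Real.rpow_nonneg (WL_pos hN hm x).le _) (Real.rpow_nonneg (WL_pos hN hl x).le _)
  have hI : Integrable (fun x : Rn N => WL m x ^ α * WL l x ^ β) := by
    refine ((WL_int hN hl hβ).const_mul (M ^ α)).mono'
      (((WL_cont m).rpow_const fun x => Or.inl (WL_pos hN hm x).ne').mul
       ((WL_cont l).rpow_const fun x => Or.inl (WL_pos hN hl x).ne')).aestronglyMeasurable
       (Filter.Eventually.of_forall fun x => ?_)
    rw [Real.norm_of_nonneg (nn x)]; exact dom x
  refine ⟨hI, ?_⟩
  calc _ ≤ ∫ x : Rn N, M ^ α * WL l x ^ β :=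
        integral_mono hI ((WL_int hN hl hβ).const_mul _) dom
    _ = M ^ α * (l ^ ((N : ℝ) - β * aN N) * ∫ x : Rn N, WL 1 x ^ β) := by
        rw [integral_const_mul, WL_int_scale hN hl]
    _ ≤ _ := by nlinarith

lemma holder {p q : ℝ} (hpq : p.HolderConjugate q) {f h : Rn N → ℝ} (hf : Continuous f)
    (hh : Continuous h) (hf0 : ∀ x, 0 ≤ f x) (hh0 : ∀ x, 0 ≤ h x)
    (hfi : Integrable fun x => f x ^ p) (hhi : Integrable fun x => h x ^ q) :
    Integrable (fun x => f x * h x) ∧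
    ∫ x, f x * h x ≤ (∫ x, f x ^ p) ^ (1 / p) * (∫ x, h x ^ q) ^ (1 / q) := by
  have hp := hpq.pos
  have hq := hpq.symm.pos
  have m1 : MemLp f (ENNReal.ofReal p) := by
    rw [← integrable_norm_rpow_iff hf.aestronglyMeasurable (by simpa using hp) (by simp)]
    rw [ENNReal.toReal_ofReal hp.le]
    simpa only [Real.norm_of_nonneg (hf0 _)] using hfi
  have m2 : MemLp h (ENNReal.ofReal q) := by
    rw [← integrable_norm_rpow_iff hh.aestronglyMeasurable (by simpa using hq) (by simp)]
    rw [ENNReal.toReal_ofReal hq.le]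
    simpa only [Real.norm_of_nonneg (hh0 _)] using hhi
  have : ENNReal.HolderConjugate (ENNReal.ofReal p) (ENNReal.ofReal q) := hpq.ennrealOfReal
  exact ⟨m1.integrable_mul m2, integral_mul_le_Lp_mul_Lq_of_nonneg hpq
    (Filter.Eventually.of_forall hf0) (Filter.Eventually.of_forall hh0) m1 m2⟩

lemma schwartz_rpow_int (g : 𝓢(Rn N, ℂ)) {e : ℝ} (he : 0 < e) : Integrable (fun x => ‖g x‖ ^ e) := by
  have := (g.memLp (ENNReal.ofReal e) volume).integrable_norm_rpow (by simpa using he) (by simp)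
  rwa [ENNReal.toReal_ofReal he.le] at this

def SS (g : 𝓢(Rn N, ℂ)) : ℝ := Real.sqrt (∫ x, ‖lapC g x‖ ^ 2)

lemma SS_nonneg (g : 𝓢(Rn N, ℂ)) : 0 ≤ SS g := Real.sqrt_nonneg _

lemma SS_sq (g : 𝓢(Rn N, ℂ)) : SS g ^ 2 = ∫ x, ‖lapC g x‖ ^ 2 :=
  Real.sq_sqrt (integral_nonneg fun _ => by positivity)

lemma sob (hN : 13 ≤ N) : ∃ C : ℝ, 0 < C ∧ ∀ g : 𝓢(Rn N, ℂ),
    ∫ x, ‖g x‖ ^ (sN N + 2) ≤ (C * SS g) ^ (sN N + 2) := by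
  obtain ⟨C, hC, h⟩ := sobolev hN
  refine ⟨C, hC, fun g => ?_⟩
  have := h g
  rwa [q_eq hN] at this

lemma T3 (hN : 13 ≤ N) : ∃ K : ℝ, 0 < K ∧ ∀ l : ℝ, 0 < l → ∀ g : 𝓢(Rn N, ℂ),
    Integrable (fun x => WL l x ^ sN N * ‖g x‖ ^ 2) ∧
    ∫ x, WL l x ^ sN N * ‖g x‖ ^ 2 ≤ K * SS g ^ 2 := by
  obtain ⟨C, hC, h⟩ := sob hN
  have hs := sN_pos hN
  have ha := aN_ge hN
  set q := sN N + 2 with hq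
  have hq0 : 0 < q := by positivity
  have hA : 0 ≤ ∫ x : Rn N, WL 1 x ^ q := integral_nonneg fun x => Real.rpow_nonneg (WL_pos hN one_pos x).le _
  refine ⟨(∫ x : Rn N, WL 1 x ^ q) ^ (1 / (q / sN N)) * C ^ 2 + 1, by positivity, fun l hl g => ?_⟩
  have hpq : (q / sN N).HolderConjugate (q / 2) := by
    rw [Real.holderConjugate_iff]
    refine ⟨by rw [lt_div_iff₀ hs]; linarith, ?_⟩
    rw [inv_div, inv_div, ← add_div, ← hq, div_self hq0.ne']
  have e1 : ∀ x : Rn N, (WL l x ^ sN N) ^ (q / sN N) = WL l x ^ q := by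
    intro x; rw [← Real.rpow_mul (WL_pos hN hl x).le]; congr 1; field_simp
  have e2 : ∀ x : Rn N, (‖g x‖ ^ 2) ^ (q / 2) = ‖g x‖ ^ q := by
    intro x; rw [← Real.rpow_natCast, ← Real.rpow_mul (norm_nonneg _)]; congr 1; push_cast; field_simp
  have := holder (N := N) hpq (f := fun x => WL l x ^ sN N) (h := fun x => ‖g x‖ ^ 2)
    ((WL_cont l).rpow_const fun x => Or.inl (WL_pos hN hl x).ne') (g.continuous.norm.pow 2)
    (fun x => Real.rpow_nonneg (WL_pos hN hl x).le _) (fun x => by positivity)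
    (by
      simp only [e1]
      refine WL_int hN hl ?_
      have := sN_mul hN
      rw [N_eq (N := N)]; nlinarith)
    (by simp only [e2]; exact schwartz_rpow_int g hq0)
  simp only [e1, e2] at this
  refine ⟨this.1, this.2.trans ?_⟩
  rw [WL_int_scale hN hl, show (N : ℝ) - q * aN N = 0 by
    have := sN_mul hN
    rw [N_eq (N := N)]; linarith, Real.rpow_zero, one_mul]
  have hS := SS_nonneg g
  have b : (∫ x, ‖g x‖ ^ q) ^ (1 / (q / 2)) ≤ C ^ 2 * SS g ^ 2 := by
    calc _ ≤ ((C * SS g) ^ q) ^ (1 / (q / 2)) := by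
          gcongr
          exact h g
      _ = _ := by
          rw [← Real.rpow_mul (by positivity), show q * (1 / (q / 2)) = (2 : ℕ) by push_cast; field_simp,
            Real.rpow_natCast, mul_pow]
  calc _ ≤ (∫ x : Rn N, WL 1 x ^ q) ^ (1 / (q / sN N)) * (C ^ 2 * SS g ^ 2) := by gcongr
    _ ≤ _ := by nlinarith [sq_nonneg (SS g)]

def a4 (N : ℕ) : ℝ := ((N : ℝ) + 3) / (2 * ((N : ℝ) - 4))
def b4 (N : ℕ) : ℝ := ((N : ℝ) + 5) / (2 * ((N : ℝ) - 4))

lemma a4_ge (hN : 13 ≤ N) : sN N ≤ a4 N := by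
  have := castN hN
  unfold sN a4
  rw [div_le_div_iff₀ (by linarith) (by linarith)]; nlinarith

lemma b4_ge (hN : 13 ≤ N) : sN N ≤ b4 N := by
  have := castN hN
  unfold sN b4
  rw [div_le_div_iff₀ (by linarith) (by linarith)]; nlinarith

lemma ab4 (hN : 13 ≤ N) : a4 N + b4 N = sN N + 1 := by
  have := castN hN
  have : (N : ℝ) - 4 ≠ 0 := by linarith
  unfold sN a4 b4
  field_simp; ring

lemma b4_mul (hN : 13 ≤ N) : b4 N * aN N = ((N : ℝ) + 5) / 4 := by
  have := castN hN
  have : (N : ℝ) - 4 ≠ 0 := by linarith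
  unfold b4 aN
  field_simp; norm_num

lemma G4 (hN : 13 ≤ N) : ∃ K : ℝ, 0 < K ∧ ∀ m l : ℝ, 1 / 2 ≤ m → m ≤ 2 → 0 < l → l ≤ 1 →
    ∀ g : 𝓢(Rn N, ℂ),
    Integrable (fun x => WL m x ^ a4 N * WL l x ^ b4 N * ‖g x‖) ∧
    ∫ x, WL m x ^ a4 N * WL l x ^ b4 N * ‖g x‖ ≤ K * (l * l ^ aN N + SS g ^ 2) := by
  obtain ⟨C, hC, h⟩ := sob hN
  have hs := sN_pos hN
  have ha := aN_ge hN
  have hNr := castN hN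
  have hsa := sN_mul hN
  set q := sN N + 2 with hq
  have hq0 : 0 < q := by positivity
  set r := 2 * (N : ℝ) / (N + 4) with hr
  have hr0 : 0 < r := by positivity
  have hqr : q = 2 * (N : ℝ) / ((N : ℝ) - 4) := by rw [hq, q_eq hN]
  have hr1 : 1 < r := by rw [hr, lt_div_iff₀ (by linarith)]; linarith
  have hpq : r.HolderConjugate q := by
    rw [Real.holderConjugate_iff]
    refine ⟨hr1, ?_⟩
    rw [hqr, hr, inv_div, inv_div]
    field_simp; ring
  have ha4 : 0 ≤ a4 N := hs.le.trans (a4_ge hN)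
  have hb4 : 0 ≤ b4 N := hs.le.trans (b4_ge hN)
  have hβ : (N : ℝ) < 2 * ((b4 N * r) * aN N) := by
    rw [mul_right_comm, b4_mul hN, hr]
    rw [show 2 * (((N : ℝ) + 5) / 4 * (2 * N / (N + 4))) = N * ((N + 5) / (N + 4)) by field_simp; ring]
    have : 1 < ((N : ℝ) + 5) / (N + 4) := by rw [lt_div_iff₀ (by linarith)]; linarith
    nlinarith
  obtain ⟨K, hK, hG⟩ := G3 hN (a4 N * r) (b4 N * r) (by positivity) hβ
  refine ⟨K ^ (1 / r) * C, by positivity, fun m l h1 h2 hl hl1 g => ?_⟩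
  have hm : 0 < m := by linarith
  have e1 : ∀ x : Rn N, (WL m x ^ a4 N * WL l x ^ b4 N) ^ r = WL m x ^ (a4 N * r) * WL l x ^ (b4 N * r) := by
    intro x
    have p1 := WL_pos hN hm x
    have p2 := WL_pos hN hl x
    rw [Real.mul_rpow (by positivity) (by positivity), ← Real.rpow_mul p1.le, ← Real.rpow_mul p2.le]
  have := holder (N := N) hpq (f := fun x => WL m x ^ a4 N * WL l x ^ b4 N) (h := fun x => ‖g x‖)
    (((WL_cont m).rpow_const fun x => Or.inl (WL_pos hN hm x).ne').mul
      ((WL_cont l).rpow_const fun x => Or.inl (WL_pos hN hl x).ne')) (g.continuous.norm)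
    (fun x => mul_nonneg (Real.rpow_nonneg (WL_pos hN hm x).le _) (Real.rpow_nonneg (WL_pos hN hl x).le _))
    (fun x => by positivity)
    (by simp only [e1]; exact (hG m l h1 h2 hl).1)
    (schwartz_rpow_int g hq0)
  refine ⟨this.1, this.2.trans ?_⟩
  simp only [e1]
  have hS := SS_nonneg g
  have b1 : (∫ x, ‖g x‖ ^ q) ^ (1 / q) ≤ C * SS g := by
    calc _ ≤ ((C * SS g) ^ q) ^ (1 / q) := by
          gcongr
          exact h g
      _ = _ := by
          rw [← Real.rpow_mul (by positivity), mul_one_div_cancel hq0.ne', Real.rpow_one]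
  have b2 : (∫ x : Rn N, WL m x ^ (a4 N * r) * WL l x ^ (b4 N * r)) ^ (1 / r)
      ≤ K ^ (1 / r) * l ^ (((N : ℝ) + 3) / 4) := by
    calc _ ≤ (K * l ^ ((N : ℝ) - (b4 N * r) * aN N)) ^ (1 / r) := by
          gcongr
          · exact integral_nonneg fun x => mul_nonneg (Real.rpow_nonneg (WL_pos hN hm x).le _) (Real.rpow_nonneg (WL_pos hN hl x).le _)
          · exact (hG m l h1 h2 hl).2
      _ = _ := by
          rw [Real.mul_rpow hK.le (by positivity), ← Real.rpow_mul hl.le]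
          congr 2
          rw [mul_right_comm, b4_mul hN, hr]
          field_simp; ring
  have b3 : l ^ (((N : ℝ) + 3) / 4) * SS g ≤ l * l ^ aN N + SS g ^ 2 := by
    have e3 : (l ^ (((N : ℝ) + 3) / 4)) ^ 2 ≤ l * l ^ aN N := by
      rw [← Real.rpow_natCast, ← Real.rpow_mul hl.le, ← Real.rpow_one_add' hl.le (by linarith)]
      apply Real.rpow_le_rpow_of_exponent_ge hl hl1
      unfold aN; push_cast; linarith
    nlinarith [sq_nonneg (l ^ (((N : ℝ) + 3) / 4) - SS g), sq_nonneg (l ^ (((N : ℝ) + 3) / 4) + SS g)]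
  have b4' : 0 ≤ l ^ (((N : ℝ) + 3) / 4) := by positivity
  calc _ ≤ (K ^ (1 / r) * l ^ (((N : ℝ) + 3) / 4)) * (C * SS g) := by
        gcongr
    _ = K ^ (1 / r) * C * (l ^ (((N : ℝ) + 3) / 4) * SS g) := by ring
    _ ≤ _ := by gcongr

end Bounds

end part5

section part6

open scoped SchwartzMap LineDeriv Laplacian NNReal ENNReal

section Final
variable {N : ℕ}

lemma ia {f g : Rn N → ℝ} (hf : Integrable f) (hg : Integrable g) :
    Integrable (fun x => f x + g x) := hf.add hg

lemma lapg_eq (g : 𝓢(Rn N, ℂ)) : ∃ h : 𝓢(Rn N, ℂ), ∀ x, lapC g x = h x :=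
  ⟨∑ i, dd (ee i) (dd (ee i) g), fun x => by rw [schwartz_lap]; simp⟩

lemma LW_temp (l : ℝ) : (LW (N := N) l).HasTemperateGrowth := by
  unfold LW LQ
  exact (Function.HasTemperateGrowth.const _).mul ((Function.HasTemperateGrowth.const _).mul
    (((Function.HasTemperateGrowth.const _).mul (Q_temperate _ _)).sub
      ((Function.HasTemperateGrowth.const _).mul (Q_temperate _ _))))

lemma LWg_int (l : ℝ) (g : 𝓢(Rn N, ℂ)) : Integrable (fun x => LW l x • lapC g x) := by
  obtain ⟨h, hh⟩ := lapg_eq g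
  simp only [hh]
  exact temp_int _ (LW_temp l) h

lemma Wsg_int (hN : 13 ≤ N) {l : ℝ} (hl : 0 < l) (g : 𝓢(Rn N, ℂ)) :
    Integrable (fun x => WL l x ^ (sN N + 1) • g x) := by
  refine temp_int _ ?_ g
  have : (fun x : Rn N => WL l x ^ (sN N + 1)) =
      fun x => CN N * l ^ (-aN N) * (KN N * l⁻¹ ^ 4 * Q (aN N + 4) l⁻¹ x) := funext fun x => W_eqn hN hl x
  rw [this]
  exact (Function.HasTemperateGrowth.const _).mul ((Function.HasTemperateGrowth.const _).mul (Q_temperate _ _))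

lemma ibp_inner (hN : 13 ≤ N) {l : ℝ} (hl : 0 < l) (z : ℂ) (g : 𝓢(Rn N, ℂ)) :
    ∫ x, LW l x * inner ℝ z (lapC g x) = ∫ x, WL l x ^ (sN N + 1) * inner ℝ z (g x) := by
  have h1 := integral_inner (𝕜 := ℝ) (LWg_int l g) z
  have h2 := integral_inner (𝕜 := ℝ) (Wsg_int hN hl g) z
  rw [ibp_W hN hl, ← h2] at h1
  simpa only [real_inner_smul_right] using h1

lemma LWinner_int (l : ℝ) (z : ℂ) (g : 𝓢(Rn N, ℂ)) :
    Integrable fun x => LW l x * inner ℝ z (lapC g x) := by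
  have := (LWg_int l g).const_inner (𝕜 := ℝ) z
  simpa only [real_inner_smul_right] using this

lemma Wsinner_int (hN : 13 ≤ N) {l : ℝ} (hl : 0 < l) (z : ℂ) (g : 𝓢(Rn N, ℂ)) :
    Integrable fun x => WL l x ^ (sN N + 1) * inner ℝ z (g x) := by
  have := (Wsg_int hN hl g).const_inner (𝕜 := ℝ) z
  simpa only [real_inner_smul_right] using this

lemma lapg_sq_int (g : 𝓢(Rn N, ℂ)) : Integrable fun x => ‖lapC g x‖ ^ 2 := by
  obtain ⟨h, hh⟩ := lapg_eq g
  simp only [hh]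
  have := schwartz_rpow_int h (e := 2) (by norm_num)
  simpa using this

lemma LWLW_int (hN : 13 ≤ N) {m l : ℝ} (hm : 0 < m) (hl : 0 < l) :
    Integrable fun x : Rn N => LW m x * LW l x := by
  refine ((LW_sq_int hN hm).add (LW_sq_int hN hl)).mono'
    ((LW_cont m).mul (LW_cont l)).aestronglyMeasurable (Filter.Eventually.of_forall fun x => ?_)
  rw [Real.norm_eq_abs]
  show |LW m x * LW l x| ≤ LW m x ^ 2 + LW l x ^ 2
  rw [abs_le]
  constructor <;> nlinarith [sq_nonneg (LW m x - LW l x), sq_nonneg (LW m x + LW l x)]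

lemma rsm (z : ℂ) (t : ℝ) : z * (t : ℂ) = t • z := by
  rw [Complex.real_smul, mul_comm]

lemma quad (hN : 13 ≤ N) {m l : ℝ} (hm : 0 < m) (hl : 0 < l) (z w : ℂ) (hz : ‖z‖ = 1) (hw : ‖w‖ = 1)
    (g : 𝓢(Rn N, ℂ)) :
    ∫ x, ‖lapC (fun x : Rn N => z * (WL m x : ℂ) + w * (WL l x : ℂ) + g x) x‖ ^ 2
      = 2 * (∫ x : Rn N, LW 1 x ^ 2) + SS g ^ 2 + 2 * inner ℝ z w * (∫ x : Rn N, LW m x * LW l x)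
       + 2 * (∫ x, WL m x ^ (sN N + 1) * inner ℝ z (g x))
       + 2 * (∫ x, WL l x ^ (sN N + 1) * inner ℝ w (g x)) := by
  have e : ∀ x : Rn N, ‖lapC (fun x : Rn N => z * (WL m x : ℂ) + w * (WL l x : ℂ) + g x) x‖ ^ 2
      = ((((LW m x ^ 2 + LW l x ^ 2) + ‖lapC g x‖ ^ 2) + 2 * inner ℝ z w * (LW m x * LW l x))
        + 2 * (LW m x * inner ℝ z (lapC g x))) + 2 * (LW l x * inner ℝ w (lapC g x)) := by
    intro x
    rw [lap_sum, rsm, rsm, norm_add_sq_real, norm_add_sq_real, norm_smul, norm_smul, hz, hw,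
      inner_add_left, real_inner_smul_left, real_inner_smul_left, real_inner_smul_left,
      real_inner_smul_right]
    simp only [Real.norm_eq_abs, mul_one, sq_abs]
    ring
  simp only [e]
  have i1 := LW_sq_int hN hm
  have i2 := LW_sq_int hN hl
  have i3 := lapg_sq_int g
  have i4 := (LWLW_int hN hm hl).const_mul (2 * inner ℝ z w)
  have i5 := (LWinner_int m z g).const_mul 2
  have i6 := (LWinner_int l w g).const_mul 2
  rw [integral_add (ia (ia (ia (ia i1 i2) i3) i4) i5) i6,
    integral_add (ia (ia (ia i1 i2) i3) i4) i5, integral_add (ia (ia i1 i2) i3) i4,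
    integral_add (ia i1 i2) i3, integral_add i1 i2, integral_const_mul, integral_const_mul,
    integral_const_mul, ibp_inner hN hm, ibp_inner hN hl, LW_int_scale hm, LW_int_scale hl, SS_sq]
  ring

lemma FNL_eq (hN : 13 ≤ N) (z : ℂ) : FNL N z = Fs (sN N) z := by
  have := castN hN
  unfold FNL Fs
  rw [q_eq hN, ← q_eq hN]
  congr 1
  rw [one_div, inv_div]

lemma Fs_cont (hN : 13 ≤ N) : Continuous (Fs (sN N)) := by
  have := sN_pos hN
  unfold Fs
  exact continuous_const.mul (continuous_norm.rpow_const fun x => Or.inr (by linarith))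

lemma fs_cont (hN : 13 ≤ N) : Continuous (fs (sN N)) := by
  have := sN_pos hN
  unfold fs
  exact (continuous_norm.rpow_const fun x => Or.inr (by linarith)).smul continuous_id

lemma Fs_W (hN : 13 ≤ N) {m : ℝ} (hm : 0 < m) (z : ℂ) (hz : ‖z‖ = 1) :
    Integrable (fun x : Rn N => Fs (sN N) (z * (WL m x : ℂ))) ∧
    ∫ x : Rn N, Fs (sN N) (z * (WL m x : ℂ)) = ∫ x : Rn N, Fs (sN N) (WL 1 x : ℂ) := by
  have hs := sN_pos hN
  have ha := aN_ge hN
  have hsa := sN_mul hN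
  have e : ∀ (m : ℝ), 0 < m → ∀ (z : ℂ), ‖z‖ = 1 → ∀ x : Rn N, Fs (sN N) (z * (WL m x : ℂ)) = (1 / (sN N + 2)) * WL m x ^ (sN N + 2) := by
    intro m hm z hz x
    unfold Fs
    rw [norm_mul, hz, one_mul, Complex.norm_real, Real.norm_of_nonneg (WL_pos hN hm x).le]
  have e1 : ∀ x : Rn N, Fs (sN N) (WL 1 x : ℂ) = (1 / (sN N + 2)) * WL 1 x ^ (sN N + 2) := by
    intro x
    have := e 1 one_pos 1 (by simp) x
    rwa [one_mul] at this
  simp only [e m hm z hz, e1]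
  constructor
  · refine (WL_int hN hm ?_).const_mul _
    rw [N_eq (N := N)]; nlinarith
  · rw [integral_const_mul, integral_const_mul, WL_int_scale hN hm,
      show (N : ℝ) - (sN N + 2) * aN N = 0 by rw [N_eq (N := N)]; linarith]
    simp

lemma U_cont (z : ℂ) (m : ℝ) : Continuous fun x : Rn N => z * (WL m x : ℂ) :=
  continuous_const.mul (Complex.continuous_ofReal.comp (WL_cont m))

lemma U_norm (hN : 13 ≤ N) {m : ℝ} (hm : 0 < m) (z : ℂ) (hz : ‖z‖ = 1) (x : Rn N) :
    ‖z * (WL m x : ℂ)‖ = WL m x := by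
  rw [norm_mul, hz, one_mul, Complex.norm_real, Real.norm_of_nonneg (WL_pos hN hm x).le]

lemma fsU_inner (hN : 13 ≤ N) {m : ℝ} (hm : 0 < m) (z : ℂ) (hz : ‖z‖ = 1) (x : Rn N) (y : ℂ) :
    inner ℝ (fs (sN N) (z * (WL m x : ℂ))) y = WL m x ^ (sN N + 1) * inner ℝ z y := by
  rw [inner_fs, U_norm hN hm z hz, rsm, real_inner_smul_left, Real.rpow_add_one (WL_pos hN hm x).ne']
  ring

/-- interaction remainder -/
lemma I1 (hN : 13 ≤ N) : ∃ K : ℝ, 0 < K ∧ ∀ m l : ℝ, 1 / 2 ≤ m → m ≤ 2 → 0 < l →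
    ∀ z w : ℂ, ‖z‖ = 1 → ‖w‖ = 1 →
    Integrable (fun x : Rn N => Fs (sN N) (z * (WL m x : ℂ) + w * (WL l x : ℂ))
      - Fs (sN N) (z * (WL m x : ℂ)) - Fs (sN N) (w * (WL l x : ℂ))) ∧
    |∫ x : Rn N, (Fs (sN N) (z * (WL m x : ℂ) + w * (WL l x : ℂ))
      - Fs (sN N) (z * (WL m x : ℂ)) - Fs (sN N) (w * (WL l x : ℂ)))|
      ≤ K * ((|inner ℝ z w| + l) * l ^ aN N) := by
  have hs := sN_pos hN
  have ha := aN_ge hN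
  have hsa := sN_mul hN
  have hNr := castN hN
  have hN4 : (N : ℝ) - 4 ≠ 0 := by linarith
  obtain ⟨K1, hK1, h1⟩ := G2 hN
  obtain ⟨K2, hK2, h2⟩ := G3 hN 1 (sN N + 1) (by norm_num) (by rw [N_eq (N := N)]; nlinarith)
  set α := ((N : ℝ) - 2) / (N - 4) with hα
  set β := ((N : ℝ) + 2) / (N - 4) with hβ
  have hβa : β * aN N = aN N + 3 := by unfold aN; rw [hβ]; field_simp; ring
  have hα1 : 1 ≤ α := by rw [hα, le_div_iff₀ (by linarith)]; linarith
  have hβ1 : 1 ≤ β := by rw [hβ, le_div_iff₀ (by linarith)]; linarith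
  have hab : α + β = sN N + 2 := by rw [← q_eq hN, hα, hβ]; field_simp; ring
  have hs1 := sN_le hN
  obtain ⟨K3, hK3, h3⟩ := G3 hN α β (by linarith) (by rw [hβa, N_eq (N := N)]; linarith)
  refine ⟨K1 + K2 + 5 * K3, by positivity, fun m l hm1 hm2 hl z w hz hw => ?_⟩
  have hm : 0 < m := by linarith
  obtain ⟨i1, b1⟩ := h1 m l hm1 hm2 hl
  obtain ⟨i2, b2⟩ := h2 m l hm1 hm2 hl
  obtain ⟨i3, b3⟩ := h3 m l hm1 hm2 hl
  rw [show (N : ℝ) - (sN N + 1) * aN N = aN N by rw [N_eq (N := N)]; linarith] at b2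
  rw [show (N : ℝ) - β * aN N = aN N + 1 by rw [hβa, N_eq (N := N)]; linarith, Real.rpow_add_one hl.ne'] at b3
  set κ := |inner ℝ z w| with hκ
  have hκ0 : 0 ≤ κ := abs_nonneg _
  have dom : ∀ x : Rn N, ‖Fs (sN N) (z * (WL m x : ℂ) + w * (WL l x : ℂ))
      - Fs (sN N) (z * (WL m x : ℂ)) - Fs (sN N) (w * (WL l x : ℂ))‖ ≤
      (κ * (WL m x ^ (sN N + 1) * WL l x) + κ * (WL m x ^ (1 : ℝ) * WL l x ^ (sN N + 1)))
        + 5 * (WL m x ^ α * WL l x ^ β) := by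
    intro x
    have p1 := WL_pos hN hm x
    have p2 := WL_pos hN hl x
    have := Fs_sum (sN N) hs hs1 α β (by linarith) (by linarith) hab (z * (WL m x : ℂ)) (w * (WL l x : ℂ))
    rw [U_norm hN hm z hz, U_norm hN hl w hw, rsm z, rsm w, real_inner_smul_left, real_inner_smul_right,
      abs_mul, abs_mul, abs_of_pos p1, abs_of_pos p2, ← rsm z, ← rsm w] at this
    rw [Real.norm_eq_abs]
    refine this.trans_eq ?_
    rw [Real.rpow_add_one p1.ne', Real.rpow_add_one p2.ne', Real.rpow_one]
    ring
  have I12 := ia (i1.const_mul κ) (i2.const_mul κ)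
  have Id := ia I12 (i3.const_mul 5)
  constructor
  · refine Id.mono' (Continuous.aestronglyMeasurable ?_) (Filter.Eventually.of_forall dom)
    exact ((((Fs_cont hN).comp ((U_cont z m).add (U_cont w l)))).sub ((Fs_cont hN).comp (U_cont z m))).sub
      ((Fs_cont hN).comp (U_cont w l))
  · rw [← Real.norm_eq_abs]
    refine (norm_integral_le_of_norm_le Id (Filter.Eventually.of_forall dom)).trans ?_
    have : ∫ x : Rn N, ((κ * (WL m x ^ (sN N + 1) * WL l x) + κ * (WL m x ^ (1 : ℝ) * WL l x ^ (sN N + 1)))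
        + 5 * (WL m x ^ α * WL l x ^ β)) = κ * (∫ x : Rn N, WL m x ^ (sN N + 1) * WL l x)
        + κ * (∫ x : Rn N, WL m x ^ (1 : ℝ) * WL l x ^ (sN N + 1)) + 5 * ∫ x : Rn N, WL m x ^ α * WL l x ^ β := by
      rw [integral_add I12 (i3.const_mul 5), integral_add (i1.const_mul κ) (i2.const_mul κ),
        integral_const_mul, integral_const_mul, integral_const_mul]
    refine this.trans_le ?_
    have hlp := Real.rpow_pos_of_pos hl (aN N)
    have c1 := mul_le_mul_of_nonneg_left b1 hκ0
    have c2 := mul_le_mul_of_nonneg_left b2 hκ0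
    have c3 : 0 ≤ K3 * (κ * l ^ aN N) := by positivity
    have c4 : 0 ≤ K1 * (l * l ^ aN N) := by positivity
    have c5 : 0 ≤ K2 * (l * l ^ aN N) := by positivity
    linarith

lemma I2 (hN : 13 ≤ N) : ∃ K : ℝ, 0 < K ∧ ∀ m l : ℝ, 0 < m → 0 < l →
    ∀ z w : ℂ, ‖z‖ = 1 → ‖w‖ = 1 → ∀ g : 𝓢(Rn N, ℂ), SS g ≤ 1 →
    Integrable (fun x : Rn N => Fs (sN N) (z * (WL m x : ℂ) + w * (WL l x : ℂ) + g x)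
      - Fs (sN N) (z * (WL m x : ℂ) + w * (WL l x : ℂ))
      - inner ℝ (fs (sN N) (z * (WL m x : ℂ) + w * (WL l x : ℂ))) (g x)) ∧
    |∫ x : Rn N, (Fs (sN N) (z * (WL m x : ℂ) + w * (WL l x : ℂ) + g x)
      - Fs (sN N) (z * (WL m x : ℂ) + w * (WL l x : ℂ))
      - inner ℝ (fs (sN N) (z * (WL m x : ℂ) + w * (WL l x : ℂ))) (g x))|
      ≤ K * SS g ^ 2 := by
  have hs := sN_pos hN
  have hs1 := sN_le hN
  obtain ⟨K, hK, h⟩ := T3 hN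
  obtain ⟨C, hC, hS⟩ := sob hN
  refine ⟨4 * K + 2 * C ^ (sN N + 2), by positivity, fun m l hm hl z w hz hw g hg => ?_⟩
  obtain ⟨i1, b1⟩ := h m hm g
  obtain ⟨i2, b2⟩ := h l hl g
  have i3 := schwartz_rpow_int g (e := sN N + 2) (by linarith)
  have b3 := hS g
  have hS0 := SS_nonneg g
  have b4 : (C * SS g) ^ (sN N + 2) ≤ C ^ (sN N + 2) * SS g ^ 2 := by
    rw [Real.mul_rpow hC.le hS0]
    gcongr
    rw [← Real.rpow_natCast]
    rcases hS0.eq_or_lt with h0 | h0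
    · rw [← h0, Real.zero_rpow (by linarith), Real.zero_rpow (by norm_num)]
    · exact Real.rpow_le_rpow_of_exponent_ge h0 hg (by push_cast; linarith)
  have dom : ∀ x : Rn N, ‖Fs (sN N) (z * (WL m x : ℂ) + w * (WL l x : ℂ) + g x)
      - Fs (sN N) (z * (WL m x : ℂ) + w * (WL l x : ℂ))
      - inner ℝ (fs (sN N) (z * (WL m x : ℂ) + w * (WL l x : ℂ))) (g x)‖ ≤
      (2 * (WL m x ^ sN N * ‖g x‖ ^ 2) + 2 * (WL l x ^ sN N * ‖g x‖ ^ 2)) + 2 * ‖g x‖ ^ (sN N + 2) := by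
    intro x
    have p1 := WL_pos hN hm x
    have p2 := WL_pos hN hl x
    have h1 := Fs_taylor' (sN N) hs hs1 (z * (WL m x : ℂ) + w * (WL l x : ℂ)) (g x)
    have h2 : ‖z * (WL m x : ℂ) + w * (WL l x : ℂ)‖ ^ sN N ≤ WL m x ^ sN N + WL l x ^ sN N := by
      calc _ ≤ (WL m x + WL l x) ^ sN N := by
            gcongr
            refine (norm_add_le _ _).trans ?_
            rw [U_norm hN hm z hz, U_norm hN hl w hw]
        _ ≤ _ := Real.rpow_add_le_add_rpow p1.le p2.le hs.le hs1
    rw [Real.norm_eq_abs]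
    have h3 := mul_le_mul_of_nonneg_right h2 (sq_nonneg ‖g x‖)
    linarith
  have I12 := ia (i1.const_mul 2) (i2.const_mul 2)
  have Id := ia I12 (i3.const_mul 2)
  have cUV : Continuous fun x : Rn N => z * (WL m x : ℂ) + w * (WL l x : ℂ) := (U_cont z m).add (U_cont w l)
  constructor
  · refine Id.mono' (Continuous.aestronglyMeasurable ?_) (Filter.Eventually.of_forall dom)
    exact (((Fs_cont hN).comp (cUV.add g.continuous)).sub ((Fs_cont hN).comp cUV)).sub
      (((fs_cont hN).comp cUV).inner g.continuous)
  · rw [← Real.norm_eq_abs]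
    refine (norm_integral_le_of_norm_le Id (Filter.Eventually.of_forall dom)).trans ?_
    have : ∫ x : Rn N, ((2 * (WL m x ^ sN N * ‖g x‖ ^ 2) + 2 * (WL l x ^ sN N * ‖g x‖ ^ 2)) + 2 * ‖g x‖ ^ (sN N + 2))
       = 2 * (∫ x : Rn N, WL m x ^ sN N * ‖g x‖ ^ 2)
        + 2 * (∫ x : Rn N, WL l x ^ sN N * ‖g x‖ ^ 2) + 2 * ∫ x : Rn N, ‖g x‖ ^ (sN N + 2) := by
      rw [integral_add I12 (i3.const_mul 2), integral_add (i1.const_mul 2) (i2.const_mul 2),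
        integral_const_mul, integral_const_mul, integral_const_mul]
    refine this.trans_le ?_
    linarith

lemma I3 (hN : 13 ≤ N) : ∃ K : ℝ, 0 < K ∧ ∀ m l : ℝ, 1 / 2 ≤ m → m ≤ 2 → 0 < l → l ≤ 1 →
    ∀ z w : ℂ, ‖z‖ = 1 → ‖w‖ = 1 → ∀ g : 𝓢(Rn N, ℂ),
    Integrable (fun x : Rn N => inner ℝ (fs (sN N) (z * (WL m x : ℂ) + w * (WL l x : ℂ))
      - fs (sN N) (z * (WL m x : ℂ)) - fs (sN N) (w * (WL l x : ℂ))) (g x)) ∧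
    |∫ x : Rn N, inner ℝ (fs (sN N) (z * (WL m x : ℂ) + w * (WL l x : ℂ))
      - fs (sN N) (z * (WL m x : ℂ)) - fs (sN N) (w * (WL l x : ℂ))) (g x)|
      ≤ K * (l * l ^ aN N + SS g ^ 2) := by
  have hs := sN_pos hN
  have hs1 := sN_le hN
  obtain ⟨K, hK, h⟩ := G4 hN
  refine ⟨5 * K, by positivity, fun m l hm1 hm2 hl hl1 z w hz hw g => ?_⟩
  have hm : 0 < m := by linarith
  obtain ⟨i1, b1⟩ := h m l hm1 hm2 hl hl1 g
  have dom : ∀ x : Rn N, ‖inner ℝ (fs (sN N) (z * (WL m x : ℂ) + w * (WL l x : ℂ))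
      - fs (sN N) (z * (WL m x : ℂ)) - fs (sN N) (w * (WL l x : ℂ))) (g x)‖ ≤
      5 * (WL m x ^ a4 N * WL l x ^ b4 N * ‖g x‖) := by
    intro x
    have h1 := fs_sum (sN N) hs hs1 (a4 N) (b4 N) (a4_ge hN) (b4_ge hN) (ab4 hN) (z * (WL m x : ℂ)) (w * (WL l x : ℂ))
    rw [U_norm hN hm z hz, U_norm hN hl w hw] at h1
    refine (norm_inner_le_norm _ _).trans ?_
    rw [← mul_assoc]
    gcongr
  have Id := i1.const_mul 5
  constructor
  · refine Id.mono' (Continuous.aestronglyMeasurable ?_) (Filter.Eventually.of_forall dom)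
    exact ((((fs_cont hN).comp ((U_cont z m).add (U_cont w l))).sub ((fs_cont hN).comp (U_cont z m))).sub
      ((fs_cont hN).comp (U_cont w l))).inner g.continuous
  · rw [← Real.norm_eq_abs]
    refine (norm_integral_le_of_norm_le Id (Filter.Eventually.of_forall dom)).trans ?_
    rw [integral_const_mul]
    linarith

lemma energy_bound (hN : 13 ≤ N) : ∃ K : ℝ, 0 < K ∧ ∀ m l : ℝ, 1 / 2 ≤ m → m ≤ 2 → 0 < l → l ≤ 1 →
    ∀ z w : ℂ, ‖z‖ = 1 → ‖w‖ = 1 → ∀ g : 𝓢(Rn N, ℂ), SS g ≤ 1 →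
    |energyC (fun x : Rn N => z * (WL m x : ℂ) + w * (WL l x : ℂ) + g x)
      - 2 * energyC (fun x : Rn N => (WL 1 x : ℂ))| ≤
      K * ((|inner ℝ z w| + l) * l ^ aN N + SS g ^ 2) := by
  obtain ⟨K0, hK0, h0⟩ := G1 hN
  obtain ⟨K1, hK1, h1⟩ := I1 hN
  obtain ⟨K2, hK2, h2⟩ := I2 hN
  obtain ⟨K3, hK3, h3⟩ := I3 hN
  refine ⟨1 + K0 + K1 + K2 + K3, by positivity, fun m l hm1 hm2 hl hl1 z w hz hw g hg => ?_⟩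
  have hm : 0 < m := by linarith
  obtain ⟨i1, b1⟩ := h1 m l hm1 hm2 hl z w hz hw
  obtain ⟨i2, b2⟩ := h2 m l hm hl z w hz hw g hg
  obtain ⟨i3, b3⟩ := h3 m l hm1 hm2 hl hl1 z w hz hw g
  obtain ⟨i4, e4⟩ := Fs_W hN hm z hz
  obtain ⟨i5, e5⟩ := Fs_W hN hl w hw
  have i6 := Wsinner_int hN hm z g
  have i7 := Wsinner_int hN hl w g
  have b0 : |∫ x : Rn N, LW m x * LW l x| ≤ K0 * l ^ aN N :=
    (abs_integral_le_integral_abs).trans (h0 m l hm1 hm2 hl)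
  have split : ∫ x : Rn N, FNL N (z * (WL m x : ℂ) + w * (WL l x : ℂ) + g x) =
      (∫ x : Rn N, (Fs (sN N) (z * (WL m x : ℂ) + w * (WL l x : ℂ))
      - Fs (sN N) (z * (WL m x : ℂ)) - Fs (sN N) (w * (WL l x : ℂ)))) +
      (∫ x : Rn N, (Fs (sN N) (z * (WL m x : ℂ) + w * (WL l x : ℂ) + g x)
      - Fs (sN N) (z * (WL m x : ℂ) + w * (WL l x : ℂ))
      - inner ℝ (fs (sN N) (z * (WL m x : ℂ) + w * (WL l x : ℂ))) (g x))) +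
      (∫ x : Rn N, inner ℝ (fs (sN N) (z * (WL m x : ℂ) + w * (WL l x : ℂ))
      - fs (sN N) (z * (WL m x : ℂ)) - fs (sN N) (w * (WL l x : ℂ))) (g x)) +
      (∫ x : Rn N, Fs (sN N) (z * (WL m x : ℂ))) + (∫ x : Rn N, Fs (sN N) (w * (WL l x : ℂ))) +
      (∫ x, WL m x ^ (sN N + 1) * inner ℝ z (g x)) + (∫ x, WL l x ^ (sN N + 1) * inner ℝ w (g x)) := by
    have j2 := ia i1 i2
    have j3 := ia j2 i3
    have j4 := ia j3 i4
    have j5 := ia j4 i5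
    have j6 := ia j5 i6
    rw [← integral_add i1 i2, ← integral_add j2 i3, ← integral_add j3 i4,
      ← integral_add j4 i5, ← integral_add j5 i6, ← integral_add j6 i7]
    refine integral_congr_ae (Filter.Eventually.of_forall fun x => ?_)
    beta_reduce
    rw [FNL_eq hN, inner_sub_left, inner_sub_left, fsU_inner hN hm z hz, fsU_inner hN hl w hw]
    ring
  have eW : energyC (fun x : Rn N => (WL 1 x : ℂ)) = (1 / 2) * (∫ x : Rn N, LW 1 x ^ 2)
      - ∫ x : Rn N, Fs (sN N) (WL 1 x : ℂ) := by
    unfold energyC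
    congr 2
    · refine integral_congr_ae (Filter.Eventually.of_forall fun x => ?_)
      have := lap_zW (N := N) 1 1 x
      simp only [one_mul] at this
      simp only [this, Complex.norm_real, Real.norm_eq_abs, sq_abs]
    · simp only [FNL_eq hN]
  rw [eW]
  unfold energyC
  rw [quad hN hm hl z w hz hw g, split, e4, e5]
  set J0 := ∫ x : Rn N, LW m x * LW l x
  set J1 := ∫ x : Rn N, (Fs (sN N) (z * (WL m x : ℂ) + w * (WL l x : ℂ))
      - Fs (sN N) (z * (WL m x : ℂ)) - Fs (sN N) (w * (WL l x : ℂ)))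
  set J2 := ∫ x : Rn N, (Fs (sN N) (z * (WL m x : ℂ) + w * (WL l x : ℂ) + g x)
      - Fs (sN N) (z * (WL m x : ℂ) + w * (WL l x : ℂ))
      - inner ℝ (fs (sN N) (z * (WL m x : ℂ) + w * (WL l x : ℂ))) (g x))
  set J3 := ∫ x : Rn N, inner ℝ (fs (sN N) (z * (WL m x : ℂ) + w * (WL l x : ℂ))
      - fs (sN N) (z * (WL m x : ℂ)) - fs (sN N) (w * (WL l x : ℂ))) (g x)
  have key : ∀ A B D E k S : ℝ, 1 / 2 * (2 * A + S + 2 * k * J0 + 2 * D + 2 * E) -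
      (J1 + J2 + J3 + B + B + D + E) - 2 * (1 / 2 * A - B) = S / 2 + k * J0 - J1 - J2 - J3 := by
    intros; ring
  rw [key]
  set k := inner ℝ z w
  have hlp := Real.rpow_pos_of_pos hl (aN N)
  have bk : |k * J0| ≤ |k| * (K0 * l ^ aN N) := by
    rw [abs_mul]; gcongr
  have hk := abs_nonneg k
  rw [abs_le] at b1 b2 b3 bk
  have P := sq_nonneg (SS g)
  have t1 : 0 ≤ l * l ^ aN N := by positivity
  have t2 : 0 ≤ |k| * l ^ aN N := by positivity
  set T := (|k| + l) * l ^ aN N with hT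
  have hT' : T = |k| * l ^ aN N + l * l ^ aN N := by rw [hT]; ring
  have u0 : |k| * (K0 * l ^ aN N) ≤ K0 * T := by
    rw [hT']; nlinarith
  have u3 : K3 * (l * l ^ aN N + SS g ^ 2) ≤ K3 * (T + SS g ^ 2) := by
    gcongr; rw [hT']; linarith
  have T0 : 0 ≤ T := by rw [hT']; linarith
  have v0 : 0 ≤ K0 * SS g ^ 2 := by positivity
  have v1 : 0 ≤ K1 * SS g ^ 2 := by positivity
  have v2 : 0 ≤ K2 * T := by positivity
  rw [abs_le]
  constructor <;> linarith

lemma cexp_norm (θ : ℝ) : ‖cexp θ‖ = 1 := by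
  unfold cexp; rw [mul_comm]; exact Complex.norm_exp_ofReal_mul_I θ

lemma cexp_inner (ζ θ : ℝ) : |inner ℝ (cexp ζ) (cexp θ)| ≤ |ζ + Real.pi / 2| + |θ| := by
  have h : inner ℝ (cexp ζ) (cexp θ) = Real.sin (ζ + Real.pi / 2 - θ) := by
    rw [show ζ + Real.pi / 2 - θ = (ζ - θ) + Real.pi / 2 by ring, Real.sin_add_pi_div_two, Real.cos_sub]
    unfold cexp
    rw [mul_comm, mul_comm Complex.I, Complex.inner]
    simp [Complex.exp_ofReal_mul_I_re, Complex.exp_ofReal_mul_I_im]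
    ring
  rw [h]
  calc _ ≤ |ζ + Real.pi / 2 - θ| := Real.abs_sin_le_abs
    _ ≤ _ := abs_sub _ _

end Final

end part6

theorem stmt_17 (N : ℕ) (hN : 13 ≤ N) :
    ∃ η C : ℝ, 0 < η ∧ 0 < C ∧
      ∀ (ζ θ μ lam : ℝ), 0 < μ → 0 < lam →
      ∀ g : SchwartzMap (Rn N) ℂ,
        (∀ x y : Rn N, ‖x‖ = ‖y‖ → g x = g y) →
        |ζ + Real.pi / 2| + |μ - 1| + |θ| + lam
            + Real.sqrt (∫ x : Rn N, ‖lapC (⇑g) x‖ ^ 2) ≤ η →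
        pairC (fun x => Complex.I * cexp ζ * (LamR (rescR μ (Wfun N)) x : ℂ)) (⇑g) = 0 →
        pairC (fun x => cexp ζ * (rescR μ (Wfun N) x : ℂ)) (⇑g) = 0 →
        pairC (fun x => Complex.I * cexp θ * (LamR (rescR lam (Wfun N)) x : ℂ)) (⇑g) = 0 →
        pairC (fun x => cexp θ * (rescR lam (Wfun N) x : ℂ)) (⇑g) = 0 →
        |energyC (fun x : Rn N =>
              cexp ζ * (rescR μ (Wfun N) x : ℂ) + cexp θ * (rescR lam (Wfun N) x : ℂ) + g x)
            - 2 * energyC (fun x : Rn N => (Wfun N x : ℂ))|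
          ≤ C * ((|ζ + Real.pi / 2| + |μ - 1| + |θ| + lam) * lam ^ (((N : ℝ) - 4) / 2)
              + (∫ x : Rn N, ‖lapC (⇑g) x‖ ^ 2)) := by
  obtain ⟨K, hK, h⟩ := energy_bound hN
  refine ⟨1 / 2, K, by norm_num, hK, fun ζ θ μ lam hμ hl g _ hη _ _ _ _ => ?_⟩
  have h1 := abs_nonneg (ζ + Real.pi / 2)
  have h2 := abs_nonneg (μ - 1)
  have h3 := abs_nonneg θ
  have h4 := SS_nonneg g
  have hSS : SS g = Real.sqrt (∫ x : Rn N, ‖lapC (⇑g) x‖ ^ 2) := rfl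
  rw [← hSS] at hη
  have h5 : |μ - 1| ≤ 1 / 2 := by linarith
  have h6 := abs_le.1 h5
  have key := h μ lam (by linarith [h6.1]) (by linarith [h6.2]) hl (by linarith)
    (cexp ζ) (cexp θ) (cexp_norm ζ) (cexp_norm θ) g (by linarith)
  simp only [resc_eq, Wfun_eq]
  refine key.trans ?_
  have h7 := cexp_inner ζ θ
  have h8 : SS g ^ 2 = ∫ x : Rn N, ‖lapC (⇑g) x‖ ^ 2 := by
    rw [hSS]
    exact Real.sq_sqrt (integral_nonneg fun x => by positivity)
  rw [h8]
  have h9 : (0 : ℝ) ≤ lam ^ (((N : ℝ) - 4) / 2) := Real.rpow_nonneg hl.le _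
  have h10 : aN N = ((N : ℝ) - 4) / 2 := rfl
  rw [h10]
  refine mul_le_mul_of_nonneg_left ?_ hK.le
  gcongr
  linarith
end
end

section
/- Let q : ℝ^N → ℝ be a smooth radially symmetric function, q(x) = ψ(|x|) with ψ smooth, such that ∇q has compact support, and let h : ℝ^N → ℂ be a radially symmetric Schwartz function, h(x) = φ(|x|). Define A₀h = (1/2)·Δq·h + ∇q·∇h. Then the following virial identity holds: Re ∫_{ℝ^N} conj(A₀h)·(−Δ²h) dx = −2·∫_{ℝ^N} ( ψ''(|x|)·|φ''(|x|)|² + (ψ'(|x|)/|x|)·((N−1)/|x|²)·|φ'(|x|)|² ) dx + ∫_{ℝ^N} |∇h|²·( ∂²_{rr}(Δq) + (1/2)·Δ²q ) dx − (1/4)·∫_{ℝ^N} |h|²·Δ³q dx, where ∂²_{rr}(Δq)(x) denotes the second radial derivative of Δq, i.e. the second derivative of the profile r ↦ (Δq)(r·e) at r = |x|, and Δ²q, Δ³q are the second and third iterated Laplacians of q. -/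
open MeasureTheory

noncomputable section

noncomputable def e0 (N : ℕ) : Rn N :=
  if h : 0 < N then EuclideanSpace.single (⟨0, h⟩ : Fin N) 1 else 0

/-- One dimensional virial identity: the total derivative integrates to zero. -/
lemma oneD (m : ℕ) (R : ℝ) (hR : 0 ≤ R) (P p s t a v z : ℝ → ℝ)
    (hP : ContDiff ℝ (⊤ : ℕ∞) P) (hp : ContDiff ℝ (⊤ : ℕ∞) p) (hs : ContDiff ℝ (⊤ : ℕ∞) s)
    (ha : ContDiff ℝ (⊤ : ℕ∞) a) (hv : ContDiff ℝ (⊤ : ℕ∞) v)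
    (ep : ∀ r, 0 < r → p r = deriv (deriv P) r + ((m : ℝ) + 3) / r * deriv P r)
    (es : ∀ r, 0 < r → s r = deriv (deriv p) r + ((m : ℝ) + 3) / r * deriv p r)
    (et : ∀ r, 0 < r → t r = deriv (deriv s) r + ((m : ℝ) + 3) / r * deriv s r)
    (ev : ∀ r, 0 < r → v r = deriv (deriv a) r + ((m : ℝ) + 3) / r * deriv a r)
    (ez : ∀ r, 0 < r → z r = deriv (deriv v) r + ((m : ℝ) + 3) / r * deriv v r)
    (zP : deriv P R = 0) (zP2 : deriv (deriv P) R = 0) (zp : p R = 0) (zp1 : deriv p R = 0)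
    (zs : s R = 0) (zs1 : deriv s R = 0) :
    ∫ r in (0 : ℝ)..R,
      (r ^ (m + 3) * ((1 / 2 * p r * a r + deriv P r * deriv a r) * (-(z r)))
        + 2 * (r ^ (m + 3) * (deriv (deriv P) r * deriv (deriv a) r ^ 2)
            + ((m : ℝ) + 3) * r ^ m * (deriv P r * deriv a r ^ 2))
        - r ^ (m + 3) * (deriv a r ^ 2 * (deriv (deriv p) r + 1 / 2 * s r))
        + 1 / 4 * (r ^ (m + 3) * (a r ^ 2 * t r))) = 0 := by
  have D : ∀ f : ℝ → ℝ, ContDiff ℝ (⊤ : ℕ∞) f → ContDiff ℝ (⊤ : ℕ∞) (deriv f) := fun f hf =>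
    (contDiff_infty_iff_deriv.1 hf).2
  have H : ∀ f : ℝ → ℝ, ContDiff ℝ (⊤ : ℕ∞) f → ∀ r, HasDerivAt f (deriv f r) r := fun f hf r =>
    ((contDiff_infty_iff_deriv.1 hf).1 r).hasDerivAt
  have hP1 := D _ hP
  have hP2 := D _ hP1
  have hp1 := D _ hp
  have hs1 := D _ hs
  have ha1 := D _ ha
  have ha2 := D _ ha1
  have hv1 := D _ hv
  set F : ℝ → ℝ := fun r =>
    r ^ (m + 3) * (-(1 / 2 * p r * a r + deriv P r * deriv a r) * deriv v r
      + (1 / 2 * deriv p r * a r + 1 / 2 * p r * deriv a r + deriv (deriv P) r * deriv a r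
          + deriv P r * deriv (deriv a) r) * v r
      - 1 / 2 * deriv P r * v r ^ 2 - 1 / 2 * s r * a r * deriv a r + 1 / 4 * deriv s r * a r ^ 2
      - deriv p r * deriv a r ^ 2)
    - ((m : ℝ) + 3) * (r ^ (m + 2) * deriv (deriv P) r + r ^ (m + 1) * deriv P r) * deriv a r ^ 2
    with hF
  have cF : ContDiff ℝ (⊤ : ℕ∞) F := by
    rw [hF]; fun_prop
  have key : ∀ r, 0 < r → deriv F r =
      (r ^ (m + 3) * ((1 / 2 * p r * a r + deriv P r * deriv a r) * (-(z r)))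
        + 2 * (r ^ (m + 3) * (deriv (deriv P) r * deriv (deriv a) r ^ 2)
            + ((m : ℝ) + 3) * r ^ m * (deriv P r * deriv a r ^ 2))
        - r ^ (m + 3) * (deriv a r ^ 2 * (deriv (deriv p) r + 1 / 2 * s r))
        + 1 / 4 * (r ^ (m + 3) * (a r ^ 2 * t r))) := by
    intro r hr
    -- third order relations
    have L : ∀ f g : ℝ → ℝ, ContDiff ℝ (⊤ : ℕ∞) f →
        (∀ r, 0 < r → g r = deriv (deriv f) r + ((m : ℝ) + 3) / r * deriv f r) →
        deriv g r = deriv (deriv (deriv f)) r + ((m : ℝ) + 3) / r * deriv (deriv f) r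
          - ((m : ℝ) + 3) / r ^ 2 * deriv f r := by
      intro f g hf hg
      have e : g =ᶠ[nhds r] fun r => deriv (deriv f) r + ((m : ℝ) + 3) * r⁻¹ * deriv f r := by
        filter_upwards [lt_mem_nhds hr] with x hx
        rw [hg x hx]; ring
      rw [e.deriv_eq]
      have := ((H _ (D _ (D _ hf)) r).add
        ((((hasDerivAt_inv hr.ne').const_mul ((m : ℝ) + 3))).mul (H _ (D _ hf) r))).deriv
      refine Eq.trans this ?_
      field_simp
      ring
    have lp := L P p hP ep
    have lv := L a v ha ev
    have pw : ∀ k : ℕ, HasDerivAt (fun r : ℝ => r ^ (k + 1)) (((k : ℝ) + 1) * r ^ k) r := by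
      intro k
      simpa using hasDerivAt_pow (k + 1) r
    have w3 := pw (m + 2)
    have w2 := pw (m + 1)
    have w1 := pw m
    have dA := (((H p hp r).const_mul (1 / 2)).mul (H a ha r)).add ((H _ hP1 r).mul (H _ ha1 r))
    have dA1 := (((((H _ hp1 r).const_mul (1 / 2)).mul (H a ha r)).add
      (((H _ hp r).const_mul (1 / 2)).mul (H _ ha1 r))).add ((H _ hP2 r).mul (H _ ha1 r))).add
      ((H _ hP1 r).mul (H _ ha2 r))
    have d := (w3.mul ((((((dA.neg.mul (H _ hv1 r)).add (dA1.mul (H v hv r))).sub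
      (((H _ hP1 r).const_mul (1 / 2)).mul ((H v hv r).pow 2))).sub
      ((((H s hs r).const_mul (1 / 2)).mul (H a ha r)).mul (H _ ha1 r))).add
      (((H _ hs1 r).const_mul (1 / 4)).mul ((H a ha r).pow 2))).sub
      ((H _ hp1 r).mul ((H _ ha1 r).pow 2)))).sub
      ((((w2.mul (H _ hP2 r)).add (w1.mul (H _ hP1 r))).const_mul ((m : ℝ) + 3)).mul
        ((H _ ha1 r).pow 2))
    refine Eq.trans d.deriv ?_
    simp only [Pi.mul_apply, Pi.add_apply, Pi.sub_apply, Pi.neg_apply, Pi.pow_apply]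
    have ez' := ez r hr
    have et' := et r hr
    have es' := es r hr
    have ep' := ep r hr
    have ev' := ev r hr
    have e3 : deriv (deriv (deriv P)) r = deriv p r - ((m : ℝ) + 3) / r * deriv (deriv P) r
          + ((m : ℝ) + 3) / r ^ 2 * deriv P r := by rw [lp]; ring
    have e4 : deriv (deriv (deriv a)) r = deriv v r - ((m : ℝ) + 3) / r * deriv (deriv a) r
          + ((m : ℝ) + 3) / r ^ 2 * deriv a r := by rw [lv]; ring
    rw [e3, e4, ez', et', es', ep', ev']
    push_cast
    field_simp
    ring
  have int : ∫ r in (0 : ℝ)..R, deriv F r = F R - F 0 :=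
    intervalIntegral.integral_eq_sub_of_hasDerivAt_of_le hR cF.continuous.continuousOn
      (fun x _ => H F cF x) ((D F cF).continuous.intervalIntegrable _ _)
  have F0 : F 0 = 0 := by simp [hF]
  have FR : F R = 0 := by simp [hF, zP, zP2, zp, zp1, zs, zs1]
  rw [F0, FR, sub_zero] at int
  refine Eq.trans ?_ int
  apply intervalIntegral.integral_congr_ae
  refine Filter.Eventually.of_forall fun r hr => ?_
  rw [Set.uIoc_of_le hR] at hr
  exact (key r hr.1).symm

/-- The vector-valued Laplacian. -/
def lapG {N : ℕ} {E : Type*} [NormedAddCommGroup E] [NormedSpace ℝ E] (u : Rn N → E) (x : Rn N) : E :=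
  ∑ i : Fin N, iteratedFDeriv ℝ 2 u x (fun _ => EuclideanSpace.single i 1)

lemma norm_e0 {N : ℕ} (hN : 0 < N) : ‖e0 N‖ = 1 := by
  simp [e0, hN]

section radial
variable {N : ℕ} {E : Type*} [NormedAddCommGroup E] [NormedSpace ℝ E]

lemma hasFDerivAt_norm_aux (x : Rn N) (hx : x ≠ 0) :
    HasFDerivAt (fun y : Rn N => ‖y‖) (‖x‖⁻¹ • innerSL ℝ x) x := by
  have hn : ‖x‖ ≠ 0 := norm_ne_zero_iff.2 hx
  have h1 := (hasStrictFDerivAt_norm_sq x).hasFDerivAt.sqrt (pow_ne_zero 2 hn)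
  have h2 : (fun y : Rn N => ‖y‖) = fun y => Real.sqrt (‖y‖ ^ 2) := by
    funext y; rw [Real.sqrt_sq (norm_nonneg y)]
  rw [h2]
  rw [Real.sqrt_sq (norm_nonneg x)] at h1
  have h3 : ‖x‖⁻¹ • innerSL ℝ x = (1 / (2 * ‖x‖)) • (2 • innerSL ℝ x) := by
    ext v
    simp
    field_simp
  rw [h3]
  exact h1

lemma hasFDerivAt_radial (f : ℝ → E) (hf : ContDiff ℝ (⊤ : ℕ∞) f) (x : Rn N) (hx : x ≠ 0) :
    HasFDerivAt (fun y : Rn N => f ‖y‖)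
      ((‖x‖⁻¹ • innerSL ℝ x).smulRight (deriv f ‖x‖)) x := by
  have h1 := ((contDiff_infty_iff_deriv.1 hf).1 ‖x‖).hasDerivAt.hasFDerivAt.comp x
    (hasFDerivAt_norm_aux x hx)
  have h2 : (‖x‖⁻¹ • innerSL ℝ x).smulRight (deriv f ‖x‖) =
      (ContinuousLinearMap.toSpanSingleton ℝ (deriv f ‖x‖)).comp (‖x‖⁻¹ • innerSL ℝ x) := by
    ext v
    simp [mul_smul]
  rw [h2]
  exact h1

lemma fderiv_radial (u : Rn N → E) (f : ℝ → E) (hf : ContDiff ℝ (⊤ : ℕ∞) f)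
    (hu : ∀ x, u x = f ‖x‖) (x : Rn N) (hx : x ≠ 0) (v : Rn N) :
    fderiv ℝ u x v = (inner ℝ x v * ‖x‖⁻¹) • deriv f ‖x‖ := by
  have h1 := hasFDerivAt_radial f hf x hx
  have h2 : u = fun y => f ‖y‖ := funext hu
  rw [h2, h1.fderiv]
  simp [mul_comm]

lemma lapG_radial (u : Rn N → E) (f : ℝ → E) (hf : ContDiff ℝ (⊤ : ℕ∞) f)
    (huc : ContDiff ℝ (⊤ : ℕ∞) u)
    (hu : ∀ x, u x = f ‖x‖) (x : Rn N) (hx : x ≠ 0) :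
    lapG u x = deriv (deriv f) ‖x‖ + (((N : ℝ) - 1) / ‖x‖) • deriv f ‖x‖ := by
  have hn : ‖x‖ ≠ 0 := norm_ne_zero_iff.2 hx
  have hf1 := (contDiff_infty_iff_deriv.1 hf).2
  have d1 : DifferentiableAt ℝ (fderiv ℝ u) x :=
    ((huc.fderiv_right (m := (⊤ : ℕ∞)) (by simp)).differentiable (by simp)) x
  have h2 := hasFDerivAt_radial (deriv f) hf1 x hx
  have term : ∀ e : Rn N, fderiv ℝ (fderiv ℝ u) x e e =
      (inner ℝ e e * ‖x‖⁻¹ - (inner ℝ x e) ^ 2 * (‖x‖⁻¹) ^ 3) • deriv f ‖x‖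
        + ((inner ℝ x e) ^ 2 * (‖x‖⁻¹) ^ 2) • deriv (deriv f) ‖x‖ := by
    intro e
    have e1 : fderiv ℝ (fderiv ℝ u) x e e = fderiv ℝ (fun y => fderiv ℝ u y e) x e := by
      rw [fderiv_clm_apply d1 (by fun_prop)]
      simp
    have e2 : (fun y => fderiv ℝ u y e) =ᶠ[nhds x]
        fun y => (inner ℝ y e * ‖y‖⁻¹) • deriv f ‖y‖ := by
      filter_upwards [isOpen_ne.mem_nhds hx] with y hy
      exact fderiv_radial u f hf hu y hy e
    have h3 : HasFDerivAt (fun y : Rn N => (inner ℝ y e : ℝ)) (innerSL ℝ e) x := by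
      have := (innerSL ℝ e).hasFDerivAt (x := x)
      refine this.congr_of_eventuallyEq (Filter.Eventually.of_forall fun y => ?_)
      simp [real_inner_comm]
    have h4 := (hasDerivAt_inv hn).comp_hasFDerivAt x (hasFDerivAt_norm_aux x hx)
    have h5 := (h3.mul h4).smul h2
    rw [e1, e2.fderiv_eq]
    refine (congrArg (fun T => T e) h5.fderiv).trans ?_
    simp only [Pi.mul_apply, Function.comp_apply, add_apply, smul_apply,
      ContinuousLinearMap.smulRight_apply, innerSL_apply_apply, smul_eq_mul, smul_smul]
    rw [add_comm]
    congr 2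
    · field_simp
      ring
    · ring
  unfold lapG
  simp only [iteratedFDeriv_two_apply, term]
  rw [Finset.sum_add_distrib, ← Finset.sum_smul, ← Finset.sum_smul]
  have s1 : ∑ i : Fin N, (inner ℝ x (EuclideanSpace.single i (1 : ℝ))) ^ 2 = ‖x‖ ^ 2 := by
    rw [EuclideanSpace.real_norm_sq_eq]
    simp [EuclideanSpace.inner_single_right]
  rw [Finset.sum_sub_distrib, ← Finset.sum_mul, ← Finset.sum_mul, ← Finset.sum_mul, s1]
  have s2 : ∑ i : Fin N, (inner ℝ (EuclideanSpace.single i (1 : ℝ)) (EuclideanSpace.single i (1 : ℝ)) : ℝ)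
      = N := by
    simp
  rw [s2, add_comm]
  have a1 : ‖x‖ ^ 2 * ‖x‖⁻¹ ^ 2 = 1 := by field_simp
  have a2 : (N : ℝ) * ‖x‖⁻¹ - ‖x‖ ^ 2 * ‖x‖⁻¹ ^ 3 = ((N : ℝ) - 1) / ‖x‖ := by field_simp
  rw [a1, a2, one_smul]

lemma lapG_contDiff (u : Rn N → E) (huc : ContDiff ℝ (⊤ : ℕ∞) u) :
    ContDiff ℝ (⊤ : ℕ∞) (lapG u) := by
  unfold lapG
  simp only [iteratedFDeriv_two_apply]
  have h1 := huc.fderiv_right (m := (⊤ : ℕ∞)) (by simp)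
  have h2 := h1.fderiv_right (m := (⊤ : ℕ∞)) (by simp)
  fun_prop

lemma prof_contDiff (u : Rn N → E) (huc : ContDiff ℝ (⊤ : ℕ∞) u) :
    ContDiff ℝ (⊤ : ℕ∞) (fun r : ℝ => u (r • e0 N)) := by
  fun_prop

lemma lapG_prof (hN : 0 < N) (u : Rn N → E) (huc : ContDiff ℝ (⊤ : ℕ∞) u)
    (hu : ∀ x, u x = u (‖x‖ • e0 N)) (r : ℝ) (hr : 0 < r) :
    lapG u (r • e0 N) = deriv (deriv fun r : ℝ => u (r • e0 N)) r
      + (((N : ℝ) - 1) / r) • deriv (fun r : ℝ => u (r • e0 N)) r := by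
  have hn : ‖r • e0 N‖ = r := by rw [norm_smul, norm_e0 hN, Real.norm_of_nonneg hr.le, mul_one]
  have hx : r • e0 N ≠ 0 := by rw [← norm_ne_zero_iff, hn]; exact hr.ne'
  rw [lapG_radial u _ (prof_contDiff u huc) huc hu _ hx, hn]

lemma lapG_rad (hN : 0 < N) (u : Rn N → E) (huc : ContDiff ℝ (⊤ : ℕ∞) u)
    (hu : ∀ x, u x = u (‖x‖ • e0 N)) (x : Rn N) : lapG u x = lapG u (‖x‖ • e0 N) := by
  by_cases hx : x = 0
  · simp [hx]
  · rw [lapG_prof hN u huc hu _ (norm_pos_iff.2 hx),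
      lapG_radial u _ (prof_contDiff u huc) huc hu _ hx]

lemma lapG_vanish (u : Rn N → E) (R : ℝ) (hu : ∀ x, R < ‖x‖ → fderiv ℝ u x = 0)
    (x : Rn N) (hx : R < ‖x‖) : lapG u x = 0 := by
  unfold lapG
  have e : fderiv ℝ u =ᶠ[nhds x] fun _ => 0 := by
    filter_upwards [(isOpen_lt continuous_const continuous_norm).mem_nhds hx] with y hy
    exact hu y hy
  simp [iteratedFDeriv_two_apply, e.fderiv_eq]

lemma fderiv_vanish (u : Rn N → E) (R : ℝ) (hu : ∀ x, R < ‖x‖ → u x = 0)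
    (x : Rn N) (hx : R < ‖x‖) : fderiv ℝ u x = 0 := by
  have e : u =ᶠ[nhds x] fun _ => 0 := by
    filter_upwards [(isOpen_lt continuous_const continuous_norm).mem_nhds hx] with y hy
    exact hu y hy
  simp [e.fderiv_eq]

lemma deriv_vanish (f : ℝ → E) (R : ℝ) (hu : ∀ x, R < x → f x = 0)
    (x : ℝ) (hx : R < x) : deriv f x = 0 := by
  have e : f =ᶠ[nhds x] fun _ => 0 := by
    filter_upwards [lt_mem_nhds hx] with y hy
    exact hu y hy
  simp [e.deriv_eq]

lemma deriv_congr_pos (f g : ℝ → E) (hfg : ∀ r, 0 < r → f r = g r) (r : ℝ) (hr : 0 < r) :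
    deriv f r = deriv g r := by
  have e : f =ᶠ[nhds r] g := by
    filter_upwards [lt_mem_nhds hr] with y hy
    exact hfg y hy
  exact e.deriv_eq

lemma radial_integral (hN : 0 < N) (f : Rn N → E) (K : ℝ → E) (R : ℝ) (hR : 0 ≤ R)
    (hf : ∀ x, x ≠ 0 → ‖x‖ ^ (N - 1) • f x = K ‖x‖) (hK : ∀ r, R < r → K r = 0) :
    ∫ x, f x = ((N : ℝ) * volume.real (Metric.ball (0 : Rn N) 1)) • ∫ r in (0 : ℝ)..R, K r := by
  have : Nonempty (Fin N) := ⟨⟨0, hN⟩⟩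
  have : Nontrivial (Rn N) := inferInstance
  have e1 : ∫ x, f x = ∫ x : Rn N, (fun r : ℝ => (r ^ (N - 1))⁻¹ • K r) ‖x‖ := by
    apply integral_congr_ae
    have : ∀ᵐ x : Rn N, x ≠ 0 := by
      simp [ae_iff]
    filter_upwards [this] with x hx
    have : ‖x‖ ^ (N - 1) ≠ 0 := pow_ne_zero _ (norm_ne_zero_iff.2 hx)
    simp only [← hf x hx]
    rw [smul_smul, inv_mul_cancel₀ this, one_smul]
  rw [e1, integral_fun_norm_addHaar volume (fun r : ℝ => (r ^ (N - 1))⁻¹ • K r)]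
  have e2 : ∫ y in Set.Ioi (0 : ℝ), y ^ (Module.finrank ℝ (Rn N) - 1) • ((y ^ (N - 1))⁻¹ • K y)
      = ∫ r in (0 : ℝ)..R, K r := by
    rw [intervalIntegral.integral_of_le hR]
    have e3 : ∫ y in Set.Ioi (0 : ℝ), y ^ (Module.finrank ℝ (Rn N) - 1) • ((y ^ (N - 1))⁻¹ • K y)
      = ∫ y in Set.Ioi (0 : ℝ), K y := by
      apply setIntegral_congr_fun measurableSet_Ioi
      intro y hy
      have hy' : y ^ (N - 1) ≠ 0 := pow_ne_zero _ (ne_of_gt hy)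
      simp only [finrank_euclideanSpace, Fintype.card_fin]
      rw [smul_smul, mul_inv_cancel₀ hy', one_smul]
    rw [e3]
    apply setIntegral_eq_of_subset_of_forall_sdiff_eq_zero measurableSet_Ioi
      (Set.Ioc_subset_Ioi_self)
    intro y hy
    apply hK
    by_contra hc
    exact hy.2 ⟨hy.1, not_lt.1 hc⟩
  rw [e2]
  simp [finrank_euclideanSpace, mul_smul, Nat.cast_smul_eq_nsmul]

end radial

theorem stmt_19 (N : ℕ) (hN : 13 ≤ N)
    (q : Rn N → ℝ) (ψ : ℝ → ℝ) (hq : ContDiff ℝ (⊤ : ℕ∞) q) (hψ : ContDiff ℝ (⊤ : ℕ∞) ψ)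
    (hqrad : ∀ x : Rn N, q x = ψ ‖x‖)
    (hsupp : HasCompactSupport (gradient q))
    (h : SchwartzMap (Rn N) ℂ) (φ : ℝ → ℂ)
    (hhrad : ∀ x : Rn N, h x = φ ‖x‖) :
    (∫ x : Rn N,
        (starRingEnd ℂ)
            ((((1 : ℝ) / 2 * lapR q x : ℝ) : ℂ) * h x + fderiv ℝ (⇑h) x (gradient q x))
          * (-(lapC (lapC (⇑h)) x))).re
      = -2 * (∫ x : Rn N,
            deriv (deriv ψ) ‖x‖ * ‖deriv (deriv φ) ‖x‖‖ ^ 2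
              + (deriv ψ ‖x‖ / ‖x‖) * (((N : ℝ) - 1) / ‖x‖ ^ 2) * ‖deriv φ ‖x‖‖ ^ 2)
        + (∫ x : Rn N,
            (∑ i : Fin N, ‖fderiv ℝ (⇑h) x (EuclideanSpace.single i 1)‖ ^ 2)
              * (deriv (deriv (fun r : ℝ => lapR q (r • e0 N))) ‖x‖
                + (1 / 2) * lapR (lapR q) x))
        - (1 / 4) * (∫ x : Rn N, ‖h x‖ ^ 2 * lapR (lapR (lapR q)) x) := by
  obtain ⟨m, rfl⟩ : ∃ m, N = m + 4 := ⟨N - 4, by omega⟩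
  have hN0 : 0 < m + 4 := by omega
  have e0n := norm_e0 hN0
  -- radial symmetry
  have qr : ∀ x, q x = q (‖x‖ • e0 (m + 4)) := by
    intro x; rw [hqrad, hqrad (‖x‖ • e0 (m + 4))]; simp [norm_smul, e0n]
  have hr : ∀ x, h x = h (‖x‖ • e0 (m + 4)) := by
    intro x; rw [hhrad, hhrad (‖x‖ • e0 (m + 4))]; simp [norm_smul, e0n]
  have hc : ContDiff ℝ (⊤ : ℕ∞) (⇑h) := h.smooth _
  have lR : ∀ u : Rn (m + 4) → ℝ, lapR u = lapG u := fun u => rfl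
  have lC : ∀ u : Rn (m + 4) → ℂ, lapC u = lapG u := fun u => rfl
  simp only [lR, lC]
  have q1c := lapG_contDiff q hq
  have q2c := lapG_contDiff _ q1c
  have q3c := lapG_contDiff _ q2c
  have q1r := lapG_rad hN0 q hq qr
  have q2r := lapG_rad hN0 _ q1c q1r
  have q3r := lapG_rad hN0 _ q2c q2r
  have h1c := lapG_contDiff _ hc
  have h2c := lapG_contDiff _ h1c
  have h1r := lapG_rad hN0 _ hc hr
  have h2r := lapG_rad hN0 _ h1c h1r
  -- profiles
  set P : ℝ → ℝ := fun r => q (r • e0 (m + 4)) with hP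
  set p : ℝ → ℝ := fun r => lapG q (r • e0 (m + 4)) with hp
  set s : ℝ → ℝ := fun r => lapG (lapG q) (r • e0 (m + 4)) with hs
  set t : ℝ → ℝ := fun r => lapG (lapG (lapG q)) (r • e0 (m + 4)) with ht
  set u : ℝ → ℂ := fun r => h (r • e0 (m + 4)) with hu
  set v : ℝ → ℂ := fun r => lapG h (r • e0 (m + 4)) with hv
  set z : ℝ → ℂ := fun r => lapG (lapG h) (r • e0 (m + 4)) with hz
  have cP : ContDiff ℝ (⊤ : ℕ∞) P := prof_contDiff _ hq
  have cp : ContDiff ℝ (⊤ : ℕ∞) p := prof_contDiff _ q1c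
  have cs : ContDiff ℝ (⊤ : ℕ∞) s := prof_contDiff _ q2c
  have ct : ContDiff ℝ (⊤ : ℕ∞) t := prof_contDiff _ q3c
  have cu : ContDiff ℝ (⊤ : ℕ∞) u := prof_contDiff _ hc
  have cv : ContDiff ℝ (⊤ : ℕ∞) v := prof_contDiff _ h1c
  have cz : ContDiff ℝ (⊤ : ℕ∞) z := prof_contDiff _ h2c
  have cast : (((m + 4 : ℕ) : ℝ) - 1) = (m : ℝ) + 3 := by push_cast; ring
  have ep : ∀ r, 0 < r → p r = deriv (deriv P) r + ((m : ℝ) + 3) / r * deriv P r := by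
    intro r hr0; rw [← cast]; exact lapG_prof hN0 q hq qr r hr0
  have es : ∀ r, 0 < r → s r = deriv (deriv p) r + ((m : ℝ) + 3) / r * deriv p r := by
    intro r hr0; rw [← cast]; exact lapG_prof hN0 _ q1c q1r r hr0
  have et : ∀ r, 0 < r → t r = deriv (deriv s) r + ((m : ℝ) + 3) / r * deriv s r := by
    intro r hr0; rw [← cast]; exact lapG_prof hN0 _ q2c q2r r hr0
  have ev : ∀ r, 0 < r → v r = deriv (deriv u) r + (((m : ℝ) + 3) / r) • deriv u r := by
    intro r hr0; rw [← cast]; exact lapG_prof hN0 _ hc hr r hr0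
  have ez : ∀ r, 0 < r → z r = deriv (deriv v) r + (((m : ℝ) + 3) / r) • deriv v r := by
    intro r hr0; rw [← cast]; exact lapG_prof hN0 _ h1c h1r r hr0
  -- vanishing at infinity
  obtain ⟨R0, hR0⟩ : ∃ R0 : ℝ, ∀ x, R0 < ‖x‖ → gradient q x = 0 := by
    obtain ⟨R0, hR0⟩ := hsupp.isCompact.isBounded.subset_closedBall 0
    refine ⟨R0, fun x hx => ?_⟩
    by_contra hne
    have := hR0 (subset_tsupport _ hne)
    rw [mem_closedBall_zero_iff] at this
    linarith
  obtain ⟨R1, hR1, hR10⟩ : ∃ R1 : ℝ, (∀ x, R1 < ‖x‖ → gradient q x = 0) ∧ 0 ≤ R1 :=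
    ⟨max R0 0, fun x hx => hR0 x (lt_of_le_of_lt (le_max_left _ _) hx), le_max_right _ _⟩
  have q0v : ∀ x, R1 < ‖x‖ → fderiv ℝ q x = 0 := by
    intro x hx
    ext w
    rw [← inner_gradient_left, hR1 x hx]; simp
  have q1v := lapG_vanish q R1 q0v
  have q2v := lapG_vanish _ R1 (fderiv_vanish _ R1 q1v)
  have q3v := lapG_vanish _ R1 (fderiv_vanish _ R1 q2v)
  have nrm : ∀ r : ℝ, R1 < r → R1 < ‖r • e0 (m + 4)‖ := by
    intro r hr0
    rw [norm_smul, e0n, mul_one]; exact lt_of_lt_of_le hr0 (le_abs_self r)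
  have vp : ∀ r, R1 < r → p r = 0 := fun r hr0 => q1v _ (nrm r hr0)
  have vs : ∀ r, R1 < r → s r = 0 := fun r hr0 => q2v _ (nrm r hr0)
  have vt : ∀ r, R1 < r → t r = 0 := fun r hr0 => q3v _ (nrm r hr0)
  have vP1 : ∀ r, R1 < r → deriv P r = 0 := by
    intro r hr0
    have hd : HasFDerivAt q (0 : Rn (m + 4) →L[ℝ] ℝ) (r • e0 (m + 4)) := by
      rw [← q0v _ (nrm r hr0)]
      exact ((hq.differentiable (by simp)) _).hasFDerivAt
    have := hd.comp_hasDerivAt r ((hasDerivAt_id r).smul_const (e0 (m + 4)))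
    refine Eq.trans this.deriv ?_
    simp
  have vP2 := deriv_vanish _ R1 vP1
  have vp1 := deriv_vanish _ R1 vp
  have vp2 := deriv_vanish _ R1 vp1
  have vs1 := deriv_vanish _ R1 vs
  have D : ∀ f : ℝ → ℝ, ContDiff ℝ (⊤ : ℕ∞) f → ContDiff ℝ (⊤ : ℕ∞) (deriv f) := fun f hf =>
    (contDiff_infty_iff_deriv.1 hf).2
  have DC : ∀ f : ℝ → ℂ, ContDiff ℝ (⊤ : ℕ∞) f → ContDiff ℝ (⊤ : ℕ∞) (deriv f) := fun f hf =>
    (contDiff_infty_iff_deriv.1 hf).2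
  have kP1 := (D _ cP).continuous
  have kP2 := (D _ (D _ cP)).continuous
  have kp := cp.continuous
  have kp2 := (D _ (D _ cp)).continuous
  have ks := cs.continuous
  have kt := ct.continuous
  have ku := cu.continuous
  have ku1 := (DC _ cu).continuous
  have ku2 := (DC _ (DC _ cu)).continuous
  have kz := cz.continuous
  have Pψ : ∀ r, 0 < r → ψ r = P r := by
    intro r hr0; simp [hP, hqrad, norm_smul, e0n, abs_of_pos hr0]
  have uφ : ∀ r, 0 < r → φ r = u r := by
    intro r hr0; simp [hu, hhrad, norm_smul, e0n, abs_of_pos hr0]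
  have Pψ1 := deriv_congr_pos _ _ Pψ
  have Pψ2 := deriv_congr_pos _ _ Pψ1
  have uφ1 := deriv_congr_pos _ _ uφ
  have uφ2 := deriv_congr_pos _ _ uφ1
  -- first order radial formulas
  have fh : ∀ x : Rn (m + 4), x ≠ 0 → ∀ w, fderiv ℝ (⇑h) x w = (inner ℝ x w * ‖x‖⁻¹) • deriv u ‖x‖ :=
    fun x hx w => fderiv_radial (⇑h) u cu hr x hx w
  have fq : ∀ x : Rn (m + 4), x ≠ 0 → ∀ w, fderiv ℝ q x w = (inner ℝ x w * ‖x‖⁻¹) • deriv P ‖x‖ :=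
    fun x hx w => fderiv_radial q P cP qr x hx w
  have fhq : ∀ x : Rn (m + 4), x ≠ 0 →
      fderiv ℝ (⇑h) x (gradient q x) = ((deriv P ‖x‖ : ℝ) : ℂ) * deriv u ‖x‖ := by
    intro x hx
    have hn : ‖x‖ ≠ 0 := norm_ne_zero_iff.2 hx
    rw [fh x hx, real_inner_comm, inner_gradient_left, fq x hx, real_inner_self_eq_norm_sq,
      ← Complex.real_smul, smul_eq_mul]
    congr 1
    field_simp
  have fsum : ∀ x : Rn (m + 4), x ≠ 0 →
      ∑ i : Fin (m + 4), ‖fderiv ℝ (⇑h) x (EuclideanSpace.single i 1)‖ ^ 2 = ‖deriv u ‖x‖‖ ^ 2 := by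
    intro x hx
    have hn : ‖x‖ ≠ 0 := norm_ne_zero_iff.2 hx
    have s1 : ∑ i : Fin (m + 4), (inner ℝ x (EuclideanSpace.single i (1 : ℝ))) ^ 2 = ‖x‖ ^ 2 := by
      rw [EuclideanSpace.real_norm_sq_eq]
      simp [EuclideanSpace.inner_single_right]
    simp only [fh x hx, norm_smul, mul_pow, Real.norm_eq_abs, sq_abs]
    rw [← Finset.sum_mul, ← Finset.sum_mul, s1]
    field_simp
  -- the four integrals
  set C : ℝ := ((m + 4 : ℕ) : ℝ) * volume.real (Metric.ball (0 : Rn (m + 4)) 1) with hC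
  set R := R1 + 1 with hR
  have hR0' : 0 ≤ R := by linarith
  have hRR : R1 < R := by linarith
  have I0 := radial_integral hN0 (fun x : Rn (m + 4) => (starRingEnd ℂ)
            ((((1 : ℝ) / 2 * lapG q x : ℝ) : ℂ) * h x + fderiv ℝ (⇑h) x (gradient q x))
          * (-(lapG (lapG (⇑h)) x)))
      (fun r => ((r ^ (m + 3) : ℝ) : ℂ) * ((starRingEnd ℂ) ((((1 : ℝ) / 2 * p r : ℝ) : ℂ) * u r
        + ((deriv P r : ℝ) : ℂ) * deriv u r) * (-(z r)))) R hR0'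
      (by
        intro x hx
        rw [fhq x hx, q1r x, hr x, h2r x, Complex.real_smul]
        rfl)
      (by
        intro r hr0
        simp [vp r (hRR.trans hr0), vP1 r (hRR.trans hr0)])
  have I1 := radial_integral hN0 (fun x : Rn (m + 4) => deriv (deriv ψ) ‖x‖ * ‖deriv (deriv φ) ‖x‖‖ ^ 2
              + (deriv ψ ‖x‖ / ‖x‖) * ((((m + 4 : ℕ) : ℝ) - 1) / ‖x‖ ^ 2) * ‖deriv φ ‖x‖‖ ^ 2)
      (fun r => r ^ (m + 3) * (deriv (deriv P) r * ‖deriv (deriv u) r‖ ^ 2)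
            + ((m : ℝ) + 3) * r ^ m * (deriv P r * ‖deriv u r‖ ^ 2)) R hR0'
      (by
        intro x hx
        have hn : 0 < ‖x‖ := norm_pos_iff.2 hx
        rw [Pψ1 _ hn, Pψ2 _ hn, uφ1 _ hn, uφ2 _ hn, cast, show m + 4 - 1 = m + 3 from rfl, smul_eq_mul]
        field_simp
        ring)
      (by
        intro r hr0
        simp [vP2 r (hRR.trans hr0), vP1 r (hRR.trans hr0)])
  have I2 := radial_integral hN0 (fun x : Rn (m + 4) =>
            (∑ i : Fin (m + 4), ‖fderiv ℝ (⇑h) x (EuclideanSpace.single i 1)‖ ^ 2)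
              * (deriv (deriv p) ‖x‖ + (1 / 2) * lapG (lapG q) x))
      (fun r => r ^ (m + 3) * (‖deriv u r‖ ^ 2 * (deriv (deriv p) r + 1 / 2 * s r))) R hR0'
      (by
        intro x hx
        rw [fsum x hx, q2r x]
        rfl)
      (by
        intro r hr0
        simp [vp2 r (hRR.trans hr0), vs r (hRR.trans hr0)])
  have I3 := radial_integral hN0 (fun x : Rn (m + 4) => ‖h x‖ ^ 2 * lapG (lapG (lapG q)) x)
      (fun r => r ^ (m + 3) * (‖u r‖ ^ 2 * t r)) R hR0'
      (by
        intro x hx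
        rw [hr x, q3r x]
        rfl)
      (by
        intro r hr0
        simp [vt r (hRR.trans hr0)])
  rw [I0, I1, I2, I3, ← hC]
  have star_c : Continuous (starRingEnd ℂ) := Complex.continuous_conj
  have J0 : IntervalIntegrable (fun r : ℝ => ((r ^ (m + 3) : ℝ) : ℂ) * ((starRingEnd ℂ)
      ((((1 : ℝ) / 2 * p r : ℝ) : ℂ) * u r + ((deriv P r : ℝ) : ℂ) * deriv u r) * (-(z r)))) volume 0 R := by
    apply Continuous.intervalIntegrable
    refine Continuous.mul (by fun_prop) (Continuous.mul (star_c.comp ?_) (by fun_prop))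
    fun_prop
  have J0re := intervalIntegral.intervalIntegral_re J0
  simp only [RCLike.re_eq_complex_re] at J0re
  rw [Complex.smul_re, ← J0re]
  -- real and imaginary parts
  have dre : ∀ f : ℝ → ℂ, ContDiff ℝ (⊤ : ℕ∞) f → deriv (fun r => (f r).re) = fun r => (deriv f r).re := by
    intro f hf
    funext r
    exact (Complex.reCLM.hasFDerivAt.comp_hasDerivAt r
      ((contDiff_infty_iff_deriv.1 hf).1 r).hasDerivAt).deriv
  have dim : ∀ f : ℝ → ℂ, ContDiff ℝ (⊤ : ℕ∞) f → deriv (fun r => (f r).im) = fun r => (deriv f r).im := by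
    intro f hf
    funext r
    exact (Complex.imCLM.hasFDerivAt.comp_hasDerivAt r
      ((contDiff_infty_iff_deriv.1 hf).1 r).hasDerivAt).deriv
  have cre : ∀ f : ℝ → ℂ, ContDiff ℝ (⊤ : ℕ∞) f → ContDiff ℝ (⊤ : ℕ∞) (fun r => (f r).re) :=
    fun f hf => Complex.reCLM.contDiff.comp hf
  have cim : ∀ f : ℝ → ℂ, ContDiff ℝ (⊤ : ℕ∞) f → ContDiff ℝ (⊤ : ℕ∞) (fun r => (f r).im) :=
    fun f hf => Complex.imCLM.contDiff.comp hf
  have K1 := oneD m R hR0' P p s t (fun r => (u r).re) (fun r => (v r).re) (fun r => (z r).re)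
    cP cp cs (cre u cu) (cre v cv) ep es et
    (by
      intro r hr0
      rw [dre u cu, dre _ (DC u cu)]
      simp [ev r hr0])
    (by
      intro r hr0
      rw [dre v cv, dre _ (DC v cv)]
      simp [ez r hr0])
    (vP1 _ hRR) (vP2 _ hRR) (vp _ hRR) (vp1 _ hRR) (vs _ hRR) (vs1 _ hRR)
  have K2 := oneD m R hR0' P p s t (fun r => (u r).im) (fun r => (v r).im) (fun r => (z r).im)
    cP cp cs (cim u cu) (cim v cv) ep es et
    (by
      intro r hr0
      rw [dim u cu, dim _ (DC u cu)]
      simp [ev r hr0])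
    (by
      intro r hr0
      rw [dim v cv, dim _ (DC v cv)]
      simp [ez r hr0])
    (vP1 _ hRR) (vP2 _ hRR) (vp _ hRR) (vp1 _ hRR) (vs _ hRR) (vs1 _ hRR)
  simp only [dre u cu, dre _ (DC u cu)] at K1
  simp only [dim u cu, dim _ (DC u cu)] at K2
  have J1 : IntervalIntegrable (fun r : ℝ => r ^ (m + 3) * (deriv (deriv P) r * ‖deriv (deriv u) r‖ ^ 2)
            + ((m : ℝ) + 3) * r ^ m * (deriv P r * ‖deriv u r‖ ^ 2)) volume 0 R := by
    apply Continuous.intervalIntegrable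
    fun_prop
  have J2 : IntervalIntegrable (fun r : ℝ => r ^ (m + 3) * (‖deriv u r‖ ^ 2 * (deriv (deriv p) r + 1 / 2 * s r)))
      volume 0 R := by
    apply Continuous.intervalIntegrable
    fun_prop
  have J3 : IntervalIntegrable (fun r : ℝ => r ^ (m + 3) * (‖u r‖ ^ 2 * t r)) volume 0 R := by
    apply Continuous.intervalIntegrable
    fun_prop
  have J0' : IntervalIntegrable (fun r : ℝ => (((r ^ (m + 3) : ℝ) : ℂ) * ((starRingEnd ℂ)
      ((((1 : ℝ) / 2 * p r : ℝ) : ℂ) * u r + ((deriv P r : ℝ) : ℂ) * deriv u r) * (-(z r)))).re) volume 0 R := by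
    apply Continuous.intervalIntegrable
    refine Complex.continuous_re.comp ?_
    refine Continuous.mul (by fun_prop) (Continuous.mul (star_c.comp ?_) (by fun_prop))
    fun_prop
  have big := congrArg₂ (· + ·) K1 K2
  simp only [add_zero] at big
  rw [← intervalIntegral.integral_add (by apply Continuous.intervalIntegrable; fun_prop)
    (by apply Continuous.intervalIntegrable; fun_prop)] at big
  have tot : (∫ r in (0 : ℝ)..R, (((((r ^ (m + 3) : ℝ) : ℂ) * ((starRingEnd ℂ)
      ((((1 : ℝ) / 2 * p r : ℝ) : ℂ) * u r + ((deriv P r : ℝ) : ℂ) * deriv u r) * (-(z r)))).re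
      + 2 * (r ^ (m + 3) * (deriv (deriv P) r * ‖deriv (deriv u) r‖ ^ 2)
            + ((m : ℝ) + 3) * r ^ m * (deriv P r * ‖deriv u r‖ ^ 2)))
      - r ^ (m + 3) * (‖deriv u r‖ ^ 2 * (deriv (deriv p) r + 1 / 2 * s r)))
      + 1 / 4 * (r ^ (m + 3) * (‖u r‖ ^ 2 * t r))) = 0 := by
    refine Eq.trans ?_ big
    apply intervalIntegral.integral_congr
    intro r _
    simp only [Complex.sq_norm, Complex.normSq_apply, Complex.re_ofReal_mul]
    simp only [Complex.mul_re, Complex.conj_re, Complex.conj_im, Complex.add_re, Complex.add_im,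
      Complex.neg_re, Complex.neg_im, Complex.mul_im, Complex.ofReal_re, Complex.ofReal_im]
    ring
  rw [intervalIntegral.integral_add ((J0'.add (J1.const_mul 2)).sub J2) (J3.const_mul (1 / 4)),
    intervalIntegral.integral_sub (J0'.add (J1.const_mul 2)) J2,
    intervalIntegral.integral_add J0' (J1.const_mul 2),
    intervalIntegral.integral_const_mul, intervalIntegral.integral_const_mul] at tot
  simp only [smul_eq_mul]
  linear_combination C * tot
end
end
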